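/- arXiv:0704.2713 — 4 statements merged into one kernel-verified Lean document; each statement's English description precedes it below -/
import Mathlib

section
/- For all topological spaces (CW complexes) X and Y, the connectivity of the join satisfies conn(X * Y) ≥ conn(X) + conn(Y) + 2. -/
open Metric unitInterval

/-- A space `X` is `k`-connected (for an integer `k ≥ -1`) if it is nonempty and
every continuous map `S^l → X` extends to a continuous map `B^{l+1} → X` for all
`0 ≤ l ≤ k`; `(-1)`-connected just means nonempty. -/
def IsKConnected (X : Type*) [TopologicalSpace X] (k : ℤ) : Prop :=
  (-1 ≤ k → Nonempty X) ∧
  ∀ l : ℕ, (l : ℤ) ≤ k →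
    ∀ f : C(sphere (0 : EuclideanSpace ℝ (Fin (l + 1))) 1, X),
      ∃ g : C(closedBall (0 : EuclideanSpace ℝ (Fin (l + 1))) 1, X),
        ∀ x : sphere (0 : EuclideanSpace ℝ (Fin (l + 1))) 1,
          g ⟨x.1, sphere_subset_closedBall x.2⟩ = f x

/-- The gluing relation defining the topological join `X * Y` as a quotient of
`X × Y × [0,1]`: at time 0 the `Y`-coordinate is collapsed, at time 1 the
`X`-coordinate is collapsed. -/
def JoinRel (X Y : Type*) : (X × Y × I) → (X × Y × I) → Prop := fun a b =>
  a = b ∨ (a.2.2 = 0 ∧ b.2.2 = 0 ∧ a.1 = b.1) ∨ (a.2.2 = 1 ∧ b.2.2 = 1 ∧ a.2.1 = b.2.1)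

/-- The topological join `X * Y`. -/
def TopJoin (X Y : Type*) [TopologicalSpace X] [TopologicalSpace Y] : Type _ :=
  Quot (JoinRel X Y)

instance (X Y : Type*) [TopologicalSpace X] [TopologicalSpace Y] :
    TopologicalSpace (TopJoin X Y) :=
  instTopologicalSpaceQuot

open Set

/-- Extension property from the unit sphere to the unit ball of a normed space. -/
def ExtProp (E Z : Type*) [NormedAddCommGroup E] [TopologicalSpace Z] : Prop :=
  ∀ p : E → Z, ContinuousOn p (sphere 0 1) →
    ∃ p' : E → Z, ContinuousOn p' (closedBall 0 1) ∧ EqOn p' p (sphere 0 1)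

/-- Radial rescaling of a linear equivalence so that it preserves norms. -/
noncomputable def radial {E F : Type*} [NormedAddCommGroup E] [NormedSpace ℝ E]
    [NormedAddCommGroup F] [NormedSpace ℝ F] (L : E ≃L[ℝ] F) (x : E) : F :=
  (‖x‖ / ‖L x‖) • L x

section radial
variable {E F : Type*} [NormedAddCommGroup E] [NormedSpace ℝ E]
    [NormedAddCommGroup F] [NormedSpace ℝ F] (L : E ≃L[ℝ] F)

lemma norm_radial (x : E) : ‖radial L x‖ = ‖x‖ := by
  unfold radial
  by_cases hx : x = 0
  · simp [hx]
  · have : L x ≠ 0 := by simpa using hx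
    have h2 : ‖L x‖ ≠ 0 := by simpa using hx
    rw [norm_smul, norm_div, norm_norm, norm_norm, div_mul_cancel₀ _ h2]

lemma continuous_radial : Continuous (radial L) := by
  rw [continuous_iff_continuousAt]
  intro x
  by_cases hx : x = 0
  · subst hx
    have h0 : radial L 0 = 0 := by simp [radial]
    unfold ContinuousAt
    rw [h0, tendsto_zero_iff_norm_tendsto_zero]
    simp only [norm_radial]
    have := (continuous_norm (E := E)).tendsto 0
    simpa using this
  · have h2 : ‖L x‖ ≠ 0 := by simpa using hx
    unfold radial
    exact ((continuous_norm.continuousAt).div (L.continuous.norm.continuousAt) h2).smul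
      L.continuous.continuousAt

lemma radial_radial (x : E) : radial L.symm (radial L x) = x := by
  by_cases hx : x = 0
  · simp [hx, radial]
  · have h1 : ‖x‖ ≠ 0 := by simpa using hx
    have h2 : ‖L x‖ ≠ 0 := by simpa using hx
    have h3 : radial L.symm (radial L x) = (‖radial L x‖ / ‖L.symm (radial L x)‖) •
        L.symm (radial L x) := rfl
    rw [h3, norm_radial]
    unfold radial
    simp only [map_smul, ContinuousLinearEquiv.symm_apply_apply, norm_smul, norm_div, norm_norm,
      smul_smul]
    have : ‖x‖ / (‖x‖ / ‖L x‖ * ‖x‖) * (‖x‖ / ‖L x‖) = 1 := by field_simp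
    rw [this, one_smul]

lemma ExtProp.transfer {Z : Type*} [TopologicalSpace Z] (L : E ≃L[ℝ] F) (h : ExtProp E Z) :
    ExtProp F Z := by
  intro p hp
  obtain ⟨q, hq, hqe⟩ := h (p ∘ radial L) (hp.comp (continuous_radial L).continuousOn (by
    intro x hx
    simpa [norm_radial] using hx))
  refine ⟨q ∘ radial L.symm, hq.comp (continuous_radial L.symm).continuousOn (by
    intro x hx
    simpa [norm_radial] using hx), ?_⟩
  intro x hx
  have := hqe (x := radial L.symm x) (by simpa [norm_radial] using hx)
  have h2 := radial_radial L.symm x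
  simp only [ContinuousLinearEquiv.symm_symm] at h2
  simp only [Function.comp_apply] at this ⊢
  rw [this, h2]

end radial

lemma IsKConnected.extProp {Z : Type*} [TopologicalSpace Z] {k : ℤ} (h : IsKConnected Z k)
    {ι : Type*} [Fintype ι] (h1 : 1 ≤ Fintype.card ι) (h2 : (Fintype.card ι : ℤ) ≤ k + 1) :
    ExtProp (ι → ℝ) Z := by
  obtain ⟨l, hl⟩ : ∃ l, Fintype.card ι = l + 1 := ⟨Fintype.card ι - 1, by omega⟩
  have L : EuclideanSpace ℝ (Fin (l + 1)) ≃L[ℝ] (ι → ℝ) :=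
    ContinuousLinearEquiv.ofFinrankEq (by simp [hl])
  refine ExtProp.transfer L ?_
  intro p hp
  obtain ⟨g, hg⟩ := h.2 l (by omega) ⟨(sphere 0 1).domRestrict p, hp.domRestrict⟩
  classical
  refine ⟨fun x => if hx : x ∈ closedBall 0 1 then g ⟨x, hx⟩ else p x, ?_, ?_⟩
  · rw [continuousOn_iff_continuous_domRestrict]
    convert g.continuous using 1
    ext x
    simp only [domRestrict_apply]
    rw [dif_pos x.2]
  · intro x hx
    have : g ⟨x, sphere_subset_closedBall hx⟩ = p x := hg ⟨x, hx⟩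
    simp only
    rw [dif_pos (sphere_subset_closedBall hx), this]

lemma isKConnected_of_extProp {Z : Type*} [TopologicalSpace Z] [Nonempty Z] {k : ℤ}
    (h : ∀ l : ℕ, (l : ℤ) ≤ k → ExtProp (Fin (l + 1) → ℝ) Z) : IsKConnected Z k := by
  refine ⟨fun _ => inferInstance, fun l hl f => ?_⟩
  have L : (Fin (l + 1) → ℝ) ≃L[ℝ] EuclideanSpace ℝ (Fin (l + 1)) :=
    ContinuousLinearEquiv.ofFinrankEq (by simp)
  classical
  let p : EuclideanSpace ℝ (Fin (l + 1)) → Z := fun x =>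
    if hx : x ∈ sphere 0 1 then f ⟨x, hx⟩ else Classical.arbitrary Z
  have hpf : ∀ x : sphere (0 : EuclideanSpace ℝ (Fin (l + 1))) 1, p x = f x := by
    intro x
    simp only [p]
    rw [dif_pos x.2]
  obtain ⟨q, hq, hqe⟩ := (h l hl).transfer L p (by
    rw [continuousOn_iff_continuous_domRestrict]
    convert f.continuous using 1
    ext x
    exact hpf x)
  refine ⟨⟨(closedBall 0 1).domRestrict q, hq.domRestrict⟩, fun x => ?_⟩
  exact (hqe x.2).trans (hpf x)

/-- Extension along a homotopy. -/
lemma extend_of_homotopy {E Z : Type*} [NormedAddCommGroup E] [NormedSpace ℝ E]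
    [TopologicalSpace Z] (H : E × ℝ → Z) (hH : ContinuousOn H (sphere 0 1 ×ˢ Icc 0 1))
    (h0 : ∃ p : E → Z, ContinuousOn p (closedBall 0 1) ∧ ∀ x ∈ sphere (0 : E) 1, p x = H (x, 0)) :
    ∃ p : E → Z, ContinuousOn p (closedBall 0 1) ∧ ∀ x ∈ sphere (0 : E) 1, p x = H (x, 1) := by
  obtain ⟨p, hp, hpe⟩ := h0
  classical
  let g : E → Z := fun x => if ‖x‖ ≤ 1 / 2 then p ((2 : ℝ) • x) else
    H (‖x‖⁻¹ • x, 2 * ‖x‖ - 1)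
  have hg2 : ∀ x : E, 1 / 2 ≤ ‖x‖ → g x = H (‖x‖⁻¹ • x, 2 * ‖x‖ - 1) := by
    intro x hx
    simp only [g]
    split_ifs with h
    · have hx2 : ‖x‖ = 1 / 2 := le_antisymm h hx
      rw [hpe _ (by rw [mem_sphere_zero_iff_norm, norm_smul, hx2]; norm_num), hx2]
      norm_num
    · rfl
  have hU : closedBall (0 : E) 1 = closedBall 0 (1 / 2) ∪ {x | 1 / 2 ≤ ‖x‖ ∧ ‖x‖ ≤ 1} := by
    ext x
    simp only [mem_closedBall_zero_iff, mem_union, mem_ofPred_eq]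
    constructor
    · intro h
      rcases le_total ‖x‖ (1 / 2) with h' | h'
      · exact Or.inl h'
      · exact Or.inr ⟨h', h⟩
    · rintro (h | h)
      · linarith
      · exact h.2
  refine ⟨g, ?_, ?_⟩
  · rw [hU]
    refine ContinuousOn.union_of_isClosed ?_ ?_ isClosed_closedBall ?_
    · have : ContinuousOn (fun x : E => p ((2 : ℝ) • x)) (closedBall 0 (1 / 2)) := by
        refine hp.comp (by fun_prop) ?_
        intro x hx
        rw [mem_closedBall_zero_iff] at hx ⊢
        rw [norm_smul]
        norm_num
        linarith
      refine this.congr ?_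
      intro x hx
      rw [mem_closedBall_zero_iff] at hx
      simp only [g, if_pos hx]
    · have : ContinuousOn (fun x : E => H (‖x‖⁻¹ • x, 2 * ‖x‖ - 1))
          {x | 1 / 2 ≤ ‖x‖ ∧ ‖x‖ ≤ 1} := by
        refine hH.comp ?_ ?_
        · refine ContinuousOn.prodMk (ContinuousOn.smul (ContinuousOn.inv₀ (by fun_prop) ?_)
            (by fun_prop)) (by fun_prop)
          intro x hx h
          have := hx.1
          rw [h] at this
          norm_num at this
        · intro x hx
          have h1 : ‖x‖ ≠ 0 := by
            intro h
            have := hx.1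
            rw [h] at this
            norm_num at this
          refine ⟨?_, ?_⟩
          · rw [mem_sphere_zero_iff_norm, norm_smul, norm_inv, norm_norm, inv_mul_cancel₀ h1]
          · have := hx.1
            have := hx.2
            constructor <;> linarith
      exact this.congr fun x hx => hg2 x hx.1
    · exact (isClosed_le continuous_const continuous_norm).inter
        (isClosed_le continuous_norm continuous_const)
  · intro x hx
    rw [mem_sphere_zero_iff_norm] at hx
    rw [hg2 x (by rw [hx]; norm_num), hx]
    norm_num

set_option linter.unusedSectionVars false

section grid
variable {ι : Type*} [Fintype ι]

/-- The closed grid cell whose relative interior contains `x`. -/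
def gcell (x : ι → ℝ) : Set (ι → ℝ) := {y | ∀ i, (⌊x i⌋ : ℝ) ≤ y i ∧ y i ≤ (⌈x i⌉ : ℝ)}

/-- Index of the open grid cell containing `x`. -/
noncomputable def gidx (x : ι → ℝ) : ι → ℤ × ℤ := fun i => (⌊x i⌋, ⌈x i⌉)

/-- Dimension of the grid cell containing `x`. -/
noncomputable def gdim (x : ι → ℝ) : ℕ := (Finset.univ.filter fun i => ⌊x i⌋ ≠ ⌈x i⌉).card

lemma mem_gcell_self (x : ι → ℝ) : x ∈ gcell x := fun i => ⟨Int.floor_le _, Int.le_ceil _⟩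

lemma mem_gcell_iff {x y : ι → ℝ} :
    y ∈ gcell x ↔ ∀ i, ⌊x i⌋ ≤ ⌊y i⌋ ∧ ⌈y i⌉ ≤ ⌈x i⌉ := by
  unfold gcell
  simp only [mem_ofPred_eq, Int.le_floor, Int.ceil_le]

lemma gcell_subset {x y : ι → ℝ} (h : y ∈ gcell x) : gcell y ⊆ gcell x := by
  intro z hz
  rw [mem_gcell_iff] at *
  exact fun i => ⟨(h i).1.trans (hz i).1, (hz i).2.trans (h i).2⟩

lemma gcell_congr {x y : ι → ℝ} (h : gidx y = gidx x) : gcell y = gcell x := by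
  ext z
  rw [mem_gcell_iff, mem_gcell_iff]
  have : ∀ i, ⌊y i⌋ = ⌊x i⌋ ∧ ⌈y i⌉ = ⌈x i⌉ := fun i => by
    have := congrFun h i
    simpa [gidx] using this
  simp [this]

lemma isClosed_gcell (x : ι → ℝ) : IsClosed (gcell x) := by
  have : gcell x = ⋂ i, {y : ι → ℝ | (⌊x i⌋ : ℝ) ≤ y i} ∩ {y | y i ≤ (⌈x i⌉ : ℝ)} := by
    ext y; simp [gcell]
  rw [this]
  exact isClosed_iInter fun i => (isClosed_le continuous_const (continuous_apply i)).inter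
    (isClosed_le (continuous_apply i) continuous_const)

lemma norm_sub_le_of_mem_gcell {x y : ι → ℝ} (h : y ∈ gcell x) : ‖y - x‖ ≤ 1 := by
  rw [pi_norm_le_iff_of_nonneg zero_le_one]
  intro i
  have h1 := h i
  have h2 := Int.lt_floor_add_one (x i)
  have h3 := Int.ceil_lt_add_one (x i)
  have h4 := Int.floor_le (x i)
  have h5 := Int.le_ceil (x i)
  rw [Real.norm_eq_abs, abs_le, Pi.sub_apply]
  constructor <;> linarith

lemma ceil_le_floor_add_one' (x : ℝ) : ⌈x⌉ ≤ ⌊x⌋ + 1 := Int.ceil_le_floor_add_one x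

lemma gidx_eq_of_gdim_le {x y : ι → ℝ} (h : y ∈ gcell x) (hd : gdim x ≤ gdim y) :
    gidx y = gidx x := by
  rw [mem_gcell_iff] at h
  have hsub : (Finset.univ.filter fun i => ⌊y i⌋ ≠ ⌈y i⌉) ⊆
      (Finset.univ.filter fun i => ⌊x i⌋ ≠ ⌈x i⌉) := by
    intro i
    simp only [Finset.mem_filter, Finset.mem_univ, true_and]
    have := h i
    have := Int.floor_le_ceil (y i)
    omega
  have heq := Finset.eq_of_subset_of_card_le hsub hd
  funext i
  have h1 := h i
  have h2 := Int.floor_le_ceil (y i)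
  have h3 := Int.ceil_le_floor_add_one (x i)
  have h4 : i ∈ (Finset.univ.filter fun i => ⌊y i⌋ ≠ ⌈y i⌉) ↔
      i ∈ (Finset.univ.filter fun i => ⌊x i⌋ ≠ ⌈x i⌉) := by rw [heq]
  simp only [Finset.mem_filter, Finset.mem_univ, true_and] at h4
  simp only [gidx, Prod.mk.injEq]
  omega

/-- Subcomplex of the grid. -/
def IsSub (D : Set (ι → ℝ)) : Prop := ∀ x ∈ D, gcell x ⊆ D

lemma finite_gidx_image {D : Set (ι → ℝ)} {R : ℝ} (hD : D ⊆ closedBall 0 R) :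
    (gidx '' D).Finite := by
  have : gidx '' D ⊆ Set.pi univ fun _ : ι =>
      (Icc (⌊-R⌋) (⌈R⌉) ×ˢ Icc (⌊-R⌋) (⌈R⌉) : Set (ℤ × ℤ)) := by
    rintro _ ⟨x, hx, rfl⟩ i -
    have h1 := hD hx
    rw [mem_closedBall_zero_iff] at h1
    have h2 := (norm_le_pi_norm x i).trans h1
    rw [Real.norm_eq_abs, abs_le] at h2
    have e1 := Int.floor_mono h2.1
    have e2 := Int.ceil_mono h2.2
    have e3 := Int.floor_le_ceil (x i)
    simp only [gidx, mem_prod, mem_Icc]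
    omega
  exact (Set.Finite.pi' fun _ => (finite_Icc _ _).prod (finite_Icc _ _)).subset
    (fun x hx i => this hx i trivial)

lemma IsSub.isClosed {D : Set (ι → ℝ)} (h : IsSub D) {R : ℝ} (hD : D ⊆ closedBall 0 R) :
    IsClosed D := by
  have hf := finite_gidx_image hD
  have : D = ⋃ c ∈ gidx '' D, {y | ∀ i, ((c i).1 : ℝ) ≤ y i ∧ y i ≤ ((c i).2 : ℝ)} := by
    apply Subset.antisymm
    · intro x hx
      simp only [mem_iUnion]
      exact ⟨gidx x, ⟨x, hx, rfl⟩, mem_gcell_self x⟩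
    · intro y hy
      simp only [mem_iUnion] at hy
      obtain ⟨c, ⟨x, hx, rfl⟩, hy⟩ := hy
      exact h x hx hy
  rw [this]
  refine hf.isClosed_biUnion ?_
  rintro _ ⟨x, hx, rfl⟩
  exact isClosed_gcell x

/-- Extension over one cell. -/
lemma extend_cell {Z : Type*} [TopologicalSpace Z] (x : ι → ℝ)
    (hZ : 1 ≤ gdim x → ExtProp ({i // ⌊x i⌋ ≠ ⌈x i⌉} → ℝ) Z)
    (p : (ι → ℝ) → Z) (hp : ContinuousOn p {y | y ∈ gcell x ∧ gidx y ≠ gidx x}) :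
    ∃ q : (ι → ℝ) → Z, ContinuousOn q (gcell x) ∧
      EqOn q p {y | y ∈ gcell x ∧ gidx y ≠ gidx x} := by
  classical
  by_cases hd : 1 ≤ gdim x
  swap
  · have h0 : ∀ i, ⌊x i⌋ = ⌈x i⌉ := by
      have : gdim x = 0 := by omega
      unfold gdim at this
      rw [Finset.card_eq_zero, Finset.filter_eq_empty_iff] at this
      intro i
      simpa using this (Finset.mem_univ i)
    have hs : ∀ y ∈ gcell x, y = x := by
      intro y hy
      funext i
      have h1 := hy i
      have h2 := mem_gcell_self x i
      have h3 : (⌊x i⌋ : ℝ) = ⌈x i⌉ := by exact_mod_cast h0 i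
      linarith
    refine ⟨p, ?_, fun _ _ => rfl⟩
    exact (continuousOn_singleton p x).mono fun y hy => hs y hy
  let J := {i // ⌊x i⌋ ≠ ⌈x i⌉}
  have hJ : ∀ i : J, (⌈x i⌉ : ℝ) = ⌊x i⌋ + 1 := by
    intro i
    have h1 := i.2
    have h2 := Int.floor_le_ceil (x i)
    have h3 := Int.ceil_le_floor_add_one (x i)
    have : ⌈x i⌉ = ⌊x i⌋ + 1 := by omega
    exact_mod_cast this
  let A : (J → ℝ) → (ι → ℝ) := fun w i =>
    if h : ⌊x i⌋ ≠ ⌈x i⌉ then ⌊x i⌋ + 1 / 2 + w ⟨i, h⟩ / 2 else x i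
  let B : (ι → ℝ) → (J → ℝ) := fun y i => 2 * (y i - ⌊x i⌋ - 1 / 2)
  have hA : Continuous A := by
    refine continuous_pi fun i => ?_
    simp only [A]
    split_ifs with h <;> fun_prop
  have hB : Continuous B := by
    refine continuous_pi fun i => ?_
    simp only [B]
    fun_prop
  have hAi : ∀ w (i : J), A w i = ⌊x i⌋ + 1 / 2 + w i / 2 := by
    intro w i
    simp only [A]
    rw [dif_pos i.2]
  have hAcell : ∀ w ∈ closedBall (0 : J → ℝ) 1, A w ∈ gcell x := by
    intro w hw i
    rw [mem_closedBall_zero_iff] at hw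
    by_cases h : ⌊x i⌋ ≠ ⌈x i⌉
    · have h1 := (norm_le_pi_norm w ⟨i, h⟩).trans hw
      rw [Real.norm_eq_abs, abs_le] at h1
      have h2 := hJ ⟨i, h⟩
      have h3 := hAi w ⟨i, h⟩
      simp only at h2 h3
      rw [h2, h3]
      constructor <;> linarith
    · simp only [A]
      rw [dif_neg h]
      exact mem_gcell_self x i
  have hAbd : ∀ w ∈ sphere (0 : J → ℝ) 1, gidx (A w) ≠ gidx x := by
    intro w hw he
    rw [mem_sphere_zero_iff_norm] at hw
    have : ‖w‖ < 1 := by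
      rw [pi_norm_lt_iff zero_lt_one]
      intro i
      have h1 := congrFun he i
      simp only [gidx, Prod.mk.injEq] at h1
      have h3 := hAi w i
      have h2 := hJ i
      have h4 : A w i < ⌊x i⌋ + 1 := by
        rw [← h1.1]; exact Int.lt_floor_add_one _
      have h5 : (⌈x i⌉ : ℝ) - 1 < A w i := by
        rw [← h1.2]; linarith [Int.ceil_lt_add_one (A w i)]
      rw [Real.norm_eq_abs, abs_lt]
      constructor <;> linarith
    linarith
  have hBball : ∀ y ∈ gcell x, B y ∈ closedBall (0 : J → ℝ) 1 := by
    intro y hy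
    rw [mem_closedBall_zero_iff, pi_norm_le_iff_of_nonneg zero_le_one]
    intro i
    have h1 := hy i
    have h2 := hJ i
    simp only [B]
    rw [Real.norm_eq_abs, abs_le]
    constructor <;> linarith
  have hBsph : ∀ y ∈ gcell x, gidx y ≠ gidx x → B y ∈ sphere (0 : J → ℝ) 1 := by
    intro y hy hne
    have h1 := hBball y hy
    rw [mem_closedBall_zero_iff] at h1
    rw [mem_sphere_zero_iff_norm]
    by_contra hlt
    have hlt : ‖B y‖ < 1 := lt_of_le_of_ne h1 hlt
    apply hne
    funext i
    by_cases h : ⌊x i⌋ ≠ ⌈x i⌉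
    · have h3 := (norm_le_pi_norm (B y) ⟨i, h⟩).trans_lt hlt
      simp only [B] at h3
      rw [Real.norm_eq_abs, abs_lt] at h3
      have h2 := hJ ⟨i, h⟩
      simp only at h2
      simp only [gidx, Prod.mk.injEq]
      rw [Int.floor_eq_iff, Int.ceil_eq_iff]
      refine ⟨⟨?_, ?_⟩, ?_, ?_⟩ <;> linarith
    · push Not at h
      have h4 := mem_gcell_iff.1 hy i
      have h5 := Int.floor_le_ceil (y i)
      simp only [gidx, Prod.mk.injEq]
      omega
  have hAB : ∀ y ∈ gcell x, A (B y) = y := by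
    intro y hy
    funext i
    by_cases h : ⌊x i⌋ ≠ ⌈x i⌉
    · have h3 := hAi (B y) ⟨i, h⟩
      simp only [B] at h3
      rw [h3]
      ring
    · simp only [A]
      rw [dif_neg h]
      push Not at h
      have h1 := hy i
      have h2 := mem_gcell_self x i
      have h3 : (⌊x i⌋ : ℝ) = ⌈x i⌉ := by exact_mod_cast h
      linarith
  obtain ⟨q, hq, hqe⟩ := hZ hd (p ∘ A) (hp.comp hA.continuousOn fun w hw =>
    ⟨hAcell w (sphere_subset_closedBall hw), hAbd w hw⟩)
  refine ⟨q ∘ B, hq.comp hB.continuousOn hBball, ?_⟩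
  intro y hy
  have := hqe (hBsph y hy.1 hy.2)
  simp only [Function.comp_apply] at this ⊢
  rw [this, hAB y hy.1]

/-- Extension over a pair of subcomplexes. -/
lemma extend_sub {Z : Type*} [TopologicalSpace Z] {k : ℕ} {R : ℝ} {D' : Set (ι → ℝ)}
    (hZ : ∀ P : ι → Prop, ∀ _ : Fintype {i // P i}, 1 ≤ Fintype.card {i // P i} →
      Fintype.card {i // P i} ≤ k → ExtProp ({i // P i} → ℝ) Z)
    (hD' : IsSub D') (hR : D' ⊆ closedBall 0 R) :
    ∀ (m : ℕ) (D : Set (ι → ℝ)) (p : (ι → ℝ) → Z), IsSub D → D ⊆ D' →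
      (∀ x ∈ D', x ∉ D → gdim x ≤ k) → (gidx '' (D' \ D)).ncard ≤ m → ContinuousOn p D →
      ∃ q : (ι → ℝ) → Z, ContinuousOn q D' ∧ EqOn q p D := by
  intro m
  induction m with
  | zero =>
    intro D p hD hDD hk hm hp
    have hf : (gidx '' (D' \ D)).Finite := finite_gidx_image (sdiff_subset.trans hR)
    have h0 : gidx '' (D' \ D) = ∅ := (Set.ncard_eq_zero hf).1 (by omega)
    rw [image_eq_empty, sdiff_eq_empty] at h0
    exact ⟨p, hp.mono h0, fun _ _ => rfl⟩
  | succ m ih =>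
    intro D p hD hDD hk hm hp
    by_cases hne : (D' \ D).Nonempty
    swap
    · rw [not_nonempty_iff_eq_empty, sdiff_eq_empty] at hne
      exact ⟨p, hp.mono hne, fun _ _ => rfl⟩
    obtain ⟨x, hx, hmin⟩ : ∃ x ∈ D' \ D, ∀ y ∈ D' \ D, gdim x ≤ gdim y := by
      obtain ⟨x, hx⟩ := exists_minimalFor_of_wellFoundedLT (fun x => x ∈ D' \ D) gdim hne
      refine ⟨x, hx.1, fun y hy => ?_⟩
      by_contra hlt
      push Not at hlt
      exact absurd (hx.2 hy hlt.le) (by omega)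
    have hbd : ∀ y ∈ gcell x, (y ∈ D ↔ gidx y ≠ gidx x) := by
      intro y hy
      constructor
      · intro hyD he
        apply hx.2
        apply hD y hyD
        rw [gcell_congr he]
        exact mem_gcell_self x
      · intro he
        by_contra hyD
        exact he (gidx_eq_of_gdim_le hy (hmin y ⟨hD' x hx.1 hy, hyD⟩))
    have hZx : 1 ≤ gdim x → ExtProp ({i // ⌊x i⌋ ≠ ⌈x i⌉} → ℝ) Z := by
      intro h1
      have h2 := hk x hx.1 hx.2
      have hc : Fintype.card {i // ⌊x i⌋ ≠ ⌈x i⌉} = gdim x := by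
        rw [Fintype.card_subtype]; rfl
      exact hZ _ _ (by rw [hc]; exact h1) (by rw [hc]; exact h2)
    obtain ⟨q, hq, hqe⟩ := extend_cell x hZx p (hp.mono fun y hy => (hbd y hy.1).2 hy.2)
    classical
    let p1 : (ι → ℝ) → Z := fun y => if y ∈ D then p y else q y
    have hp1D : EqOn p1 p D := fun y hy => by simp only [p1, if_pos hy]
    have hp1c : EqOn p1 q (gcell x) := by
      intro y hy
      by_cases hyD : y ∈ D
      · rw [hp1D hyD, hqe ⟨hy, (hbd y hy).1 hyD⟩]
      · simp only [p1, if_neg hyD]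
    have hp1 : ContinuousOn p1 (D ∪ gcell x) :=
      (hp.congr hp1D).union_of_isClosed (hq.congr hp1c) (hD.isClosed (hDD.trans hR))
        (isClosed_gcell x)
    have hsub1 : IsSub (D ∪ gcell x) := by
      rintro y (hy | hy)
      · exact (hD y hy).trans subset_union_left
      · exact (gcell_subset hy).trans subset_union_right
    obtain ⟨q', hq', hqe'⟩ := ih (D ∪ gcell x) p1 hsub1 (union_subset hDD (hD' x hx.1))
      (fun y hy hy' => hk y hy fun h => hy' (Or.inl h)) (by
        have hf : (gidx '' (D' \ D)).Finite := finite_gidx_image (sdiff_subset.trans hR)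
        have : gidx '' (D' \ (D ∪ gcell x)) ⊂ gidx '' (D' \ D) := by
          refine ⟨image_mono (sdiff_subset_sdiff_right subset_union_left), fun h => ?_⟩
          obtain ⟨y, hy, he⟩ := h ⟨x, hx, rfl⟩
          apply hy.2
          right
          rw [← gcell_congr he]
          exact mem_gcell_self y
        have := Set.ncard_lt_ncard this hf
        omega) hp1
    exact ⟨q', hq', fun y hy => (hqe' (Or.inl hy)).trans (hp1D hy)⟩

/-- Extension over the skeleton. -/
lemma extend_skeleton {Z : Type*} [TopologicalSpace Z] {k : ℕ} {R : ℝ}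
    (hZ : ∀ P : ι → Prop, ∀ _ : Fintype {i // P i}, 1 ≤ Fintype.card {i // P i} →
      Fintype.card {i // P i} ≤ k → ExtProp ({i // P i} → ℝ) Z)
    (G : Set (ι → ℝ)) (hG : G ⊆ closedBall 0 R) (p : (ι → ℝ) → Z) (hp : ContinuousOn p G) :
    ∃ q : (ι → ℝ) → Z,
      ContinuousOn q ({y | gcell y ⊆ G} ∪ {y | gdim y ≤ k ∧ gcell y ⊆ closedBall 0 R}) ∧
      EqOn q p {y | gcell y ⊆ G} := by
  have h1 : IsSub {y : ι → ℝ | gcell y ⊆ G} := fun x hx y hy => (gcell_subset hy).trans hx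
  have hdim : ∀ {x y : ι → ℝ}, y ∈ gcell x → gdim y ≤ gdim x := by
    intro x y hy
    by_contra h
    push Not at h
    have h2 := gidx_eq_of_gdim_le hy h.le
    have : gdim y = gdim x := by
      unfold gdim
      congr 1
      ext i
      have := congrFun h2 i
      simp only [gidx, Prod.mk.injEq] at this
      simp only [Finset.mem_filter, this.1, this.2]
    omega
  refine extend_sub (R := R) hZ ?_ ?_ _ _ p h1 subset_union_left ?_ le_rfl (hp.mono ?_)
  · rintro x (hx | hx)
    · exact (h1 x hx).trans subset_union_left
    · intro y hy
      right
      exact ⟨(hdim hy).trans hx.1, (gcell_subset hy).trans hx.2⟩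
  · rintro x (hx | hx)
    · exact hG (hx (mem_gcell_self x))
    · exact hx.2 (mem_gcell_self x)
  · rintro x (hx | hx) hn
    · exact absurd hx hn
    · exact hx.1
  · intro y hy
    exact hy (mem_gcell_self y)

/-- Collapse towards the integers, in one variable. -/
noncomputable def rho1 (x : ℝ) : ℝ := ⌊x⌋ + max 0 (min 1 (4 * Int.fract x - 3 / 2))

lemma continuous_rho1 : Continuous rho1 := by
  have h : Continuous ((fun u : ℝ => max 0 (min 1 (4 * u - 3 / 2)) - u) ∘ Int.fract) :=
    ContinuousOn.comp_fract'' (by fun_prop) (by norm_num)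
  have : rho1 = fun x => x + ((fun u : ℝ => max 0 (min 1 (4 * u - 3 / 2)) - u) ∘ Int.fract) x := by
    funext x
    have := Int.floor_add_fract x
    simp only [rho1, Function.comp_apply]
    linarith
  rw [this]
  exact continuous_id.add h

lemma abs_rho1_sub_le (x : ℝ) : |rho1 x - x| ≤ 1 := by
  have h1 := Int.floor_add_fract x
  have h2 := Int.fract_nonneg x
  have h3 := Int.fract_lt_one x
  have h4 : 0 ≤ max 0 (min 1 (4 * Int.fract x - 3 / 2)) := le_max_left _ _
  have h5 : max 0 (min 1 (4 * Int.fract x - 3 / 2)) ≤ 1 := max_le (by norm_num) (min_le_left _ _)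
  rw [abs_le, rho1]
  constructor <;> linarith

lemma rho1_nonint {x : ℝ} (h : ⌊rho1 x⌋ ≠ ⌈rho1 x⌉) :
    3 / 8 < Int.fract x ∧ Int.fract x < 5 / 8 := by
  by_contra hc
  apply h
  rcases le_or_gt (Int.fract x) (3 / 8) with h1 | h1
  · have : rho1 x = ⌊x⌋ := by
      rw [rho1, max_eq_left ((min_le_right _ _).trans (by linarith)), add_zero]
    rw [this]; simp
  · have h2 : 5 / 8 ≤ Int.fract x := by
      by_contra h3
      exact hc ⟨h1, by linarith⟩
    have : rho1 x = ((⌊x⌋ + 1 : ℤ) : ℝ) := by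
      rw [rho1, min_eq_left (by linarith), max_eq_right (by norm_num)]
      push_cast; rfl
    rw [this]; simp

lemma rho1_sep {y z : ℝ} (hy : ⌊rho1 y⌋ ≠ ⌈rho1 y⌉)
    (hz : ⌊rho1 (z + 1 / 2)⌋ ≠ ⌈rho1 (z + 1 / 2)⌉) : 1 / 4 < |y - z| := by
  have h1 := rho1_nonint hy
  have h2 := rho1_nonint hz
  have e1 := Int.floor_add_fract y
  have e2 := Int.floor_add_fract (z + 1 / 2)
  rcases le_or_gt ⌊z + 1 / 2⌋ ⌊y⌋ with h | h
  · have : (⌊z + 1 / 2⌋ : ℝ) ≤ ⌊y⌋ := by exact_mod_cast h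
    rw [lt_abs]; left; linarith
  · have : (⌊y⌋ : ℝ) + 1 ≤ ⌊z + 1 / 2⌋ := by exact_mod_cast h
    rw [lt_abs]; right; linarith

/-- Collapse towards the integer lattice. -/
noncomputable def rho (x : ι → ℝ) : ι → ℝ := fun i => rho1 (x i)

/-- Half-integer shift. -/
noncomputable def hshift : ι → ℝ := fun _ => 1 / 2

lemma continuous_rho : Continuous (rho : (ι → ℝ) → ι → ℝ) :=
  continuous_pi fun i => continuous_rho1.comp (continuous_apply i)

lemma norm_rho_sub_le (x : ι → ℝ) : ‖rho x - x‖ ≤ 1 := by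
  rw [pi_norm_le_iff_of_nonneg zero_le_one]
  intro i
  exact abs_rho1_sub_le (x i)

/-- The separating function. -/
lemma exists_sep {k m : ℕ} (hn : Fintype.card ι ≤ k + m + 1) :
    ∃ s : (ι → ℝ) → ℝ, Continuous s ∧ (∀ x, 2 / 3 < s x ∨ gdim (rho x) ≤ k) ∧
      (∀ x, s x < 1 / 3 ∨ gdim (rho (x + hshift)) ≤ m) := by
  let FA : Set (ι → ℝ) := {x | k < gdim (rho x)}
  let FB : Set (ι → ℝ) := {x | m < gdim (rho (x + hshift))}
  have hdis : Disjoint (closure FB) (closure FA) := by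
    rw [Set.disjoint_left]
    intro x hB hA
    obtain ⟨z, hz, hzx⟩ := Metric.mem_closure_iff.1 hB (1 / 8) (by norm_num)
    obtain ⟨y, hy, hyx⟩ := Metric.mem_closure_iff.1 hA (1 / 8) (by norm_num)
    have hyz : dist y z < 1 / 4 := by
      have := dist_triangle_left y z x
      linarith
    have hdj : Disjoint (Finset.univ.filter fun i => ⌊rho y i⌋ ≠ ⌈rho y i⌉)
        (Finset.univ.filter fun i => ⌊rho (z + hshift) i⌋ ≠ ⌈rho (z + hshift) i⌉) := by
      rw [Finset.disjoint_left]
      intro i h1 h2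
      simp only [Finset.mem_filter, Finset.mem_univ, true_and] at h1 h2
      have h3 : 1 / 4 < |y i - z i| := rho1_sep h1 h2
      have h4 := dist_le_pi_dist y z i
      rw [Real.dist_eq] at h4
      linarith
    have hle := Finset.card_le_univ ((Finset.univ.filter fun i => ⌊rho y i⌋ ≠ ⌈rho y i⌉).disjUnion
      (Finset.univ.filter fun i => ⌊rho (z + hshift) i⌋ ≠ ⌈rho (z + hshift) i⌉) hdj)
    rw [Finset.card_disjUnion] at hle
    have h1 : k < gdim (rho y) := hy
    have h2 : m < gdim (rho (z + hshift)) := hz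
    unfold gdim at h1 h2
    omega
  obtain ⟨s, hs0, hs1, -⟩ := exists_continuous_zero_one_of_isClosed isClosed_closure
    isClosed_closure hdis
  refine ⟨s, s.continuous, fun x => ?_, fun x => ?_⟩
  · by_cases h : gdim (rho x) ≤ k
    · exact Or.inr h
    · left
      rw [hs1 (subset_closure (show x ∈ FA from not_le.1 h))]
      norm_num
  · by_cases h : gdim (rho (x + hshift)) ≤ m
    · exact Or.inr h
    · left
      rw [hs0 (subset_closure (show x ∈ FB from not_le.1 h))]
      norm_num

end grid

section join
variable {X Y : Type*} [TopologicalSpace X] [TopologicalSpace Y]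

/-- The quotient map onto the join. -/
def jm (a : X × Y × I) : TopJoin X Y := Quot.mk _ a

lemma isQuotientMap_jm : Topology.IsQuotientMap (jm : X × Y × I → TopJoin X Y) :=
  isQuotientMap_quot_mk

lemma continuous_jm : Continuous (jm : X × Y × I → TopJoin X Y) := isQuotientMap_jm.continuous

lemma jm_zero (x : X) (y y' : Y) : jm (x, y, 0) = jm (x, y', 0) :=
  Quot.sound (Or.inr (Or.inl ⟨rfl, rfl, rfl⟩))

lemma jm_one (x x' : X) (y : Y) : jm (x, y, 1) = jm (x', y, 1) :=
  Quot.sound (Or.inr (Or.inr ⟨rfl, rfl, rfl⟩))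

/-- The join parameter. -/
def jt : TopJoin X Y → I := Quot.lift (fun a => a.2.2) (by
  rintro a b (h | h | h)
  · rw [h]
  · rw [h.1, h.2.1]
  · rw [h.1, h.2.1])

lemma continuous_jt : Continuous (jt : TopJoin X Y → I) :=
  isQuotientMap_jm.continuous_iff.2 (continuous_snd.comp continuous_snd)

open Classical in
/-- The first coordinate of a point of the join. -/
noncomputable def jX [Nonempty X] : TopJoin X Y → X :=
  Quot.lift (fun a => if a.2.2 = 1 then Classical.arbitrary X else a.1) (by
    rintro a b (h | h | h)
    · rw [h]
    · simp only [h.1, h.2.1, h.2.2]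
    · simp only [h.1, h.2.1, if_true])

open Classical in
/-- The second coordinate of a point of the join. -/
noncomputable def jY [Nonempty Y] : TopJoin X Y → Y :=
  Quot.lift (fun a => if a.2.2 = 0 then Classical.arbitrary Y else a.2.1) (by
    rintro a b (h | h | h)
    · rw [h]
    · simp only [h.1, h.2.1, if_true]
    · simp only [h.1, h.2.1, h.2.2])

lemma continuousOn_jX [Nonempty X] : ContinuousOn (jX : TopJoin X Y → X) {z | jt z ≠ 1} := by
  rw [isQuotientMap_jm.continuousOn_isOpen_iff (s := {z | jt z ≠ 1}) (isOpen_ne.preimage continuous_jt)]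
  refine (continuous_fst.continuousOn).congr ?_
  intro a ha
  exact if_neg ha

lemma continuousOn_jY [Nonempty Y] : ContinuousOn (jY : TopJoin X Y → Y) {z | jt z ≠ 0} := by
  rw [isQuotientMap_jm.continuousOn_isOpen_iff (s := {z | jt z ≠ 0}) (isOpen_ne.preimage continuous_jt)]
  refine ((continuous_fst.comp continuous_snd).continuousOn).congr ?_
  intro a ha
  exact if_neg ha

lemma jm_coords [Nonempty X] [Nonempty Y] (z : TopJoin X Y) : jm (jX z, jY z, jt z) = z := by
  obtain ⟨⟨x, y, t⟩, rfl⟩ := isQuotientMap_jm.surjective z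
  have ht : jt (jm (x, y, t)) = t := rfl
  have hX : t ≠ 1 → jX (jm (x, y, t)) = x := fun h => if_neg h
  have hY : t ≠ 0 → jY (jm (x, y, t)) = y := fun h => if_neg h
  rw [ht]
  by_cases h0 : t = 0
  · rw [hX (by rw [h0]; exact zero_ne_one), h0]
    exact jm_zero _ _ _
  · by_cases h1 : t = 1
    · rw [hY h0, h1]
      exact jm_one _ _ _
    · rw [hX h1, hY h0]

/-- The reparametrization. -/
noncomputable def phi (t : ℝ) : I := Set.projIcc 0 1 zero_le_one (3 * t - 1)

lemma continuous_phi : Continuous phi := continuous_projIcc.comp (by fun_prop)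

lemma phi_zero {t : ℝ} (h : t ≤ 1 / 3) : phi t = 0 := projIcc_of_le_left _ (by linarith)

lemma phi_one {t : ℝ} (h : 2 / 3 ≤ t) : phi t = 1 := projIcc_of_right_le _ (by linarith)

lemma jm_phi_congr {x x' : X} {y y' : Y} {t : ℝ} (hx : t ≤ 2 / 3 → x = x')
    (hy : 1 / 3 ≤ t → y = y') : jm (x, y, phi t) = jm (x', y', phi t) := by
  rcases le_or_gt t (1 / 3) with h | h
  · rw [phi_zero h, hx (by linarith)]
    exact jm_zero _ _ _
  · rcases le_or_gt t (2 / 3) with h' | h'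
    · rw [hx h', hy h.le]
    · rw [phi_one h'.le, hy h.le]
      exact jm_one _ _ _

/-- Gluing maps into the join. -/
lemma continuousOn_glue {W : Type*} [TopologicalSpace W] {S : Set W} (hS : IsClosed S)
    (τ : W → ℝ) (hτ : ContinuousOn τ S) (p : W → X) (q : W → Y)
    (hp : ContinuousOn p (S ∩ {w | τ w ≤ 2 / 3})) (hq : ContinuousOn q (S ∩ {w | 1 / 3 ≤ τ w})) :
    ContinuousOn (fun w => jm (p w, q w, phi (τ w))) S := by
  have hc1 : IsClosed (S ∩ {w | τ w ≤ 1 / 3}) := hτ.preimage_isClosed_of_isClosed hS isClosed_Iic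
  have hc2 : IsClosed (S ∩ {w | τ w ∈ Icc (1 / 3 : ℝ) (2 / 3)}) :=
    hτ.preimage_isClosed_of_isClosed hS isClosed_Icc
  have hc3 : IsClosed (S ∩ {w | 2 / 3 ≤ τ w}) := hτ.preimage_isClosed_of_isClosed hS isClosed_Ici
  have hU : S = (S ∩ {w | τ w ≤ 1 / 3}) ∪ ((S ∩ {w | τ w ∈ Icc (1 / 3 : ℝ) (2 / 3)}) ∪
      (S ∩ {w | 2 / 3 ≤ τ w})) := by
    ext w
    simp only [mem_union, mem_inter_iff, mem_ofPred_eq, mem_Icc]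
    constructor
    · intro h
      rcases le_total (τ w) (1 / 3) with h1 | h1
      · exact Or.inl ⟨h, h1⟩
      · rcases le_total (τ w) (2 / 3) with h2 | h2
        · exact Or.inr (Or.inl ⟨h, h1, h2⟩)
        · exact Or.inr (Or.inr ⟨h, h2⟩)
    · rintro (h | h | h) <;> exact h.1
  rw [hU]
  refine ContinuousOn.union_of_isClosed ?_ (ContinuousOn.union_of_isClosed ?_ ?_ hc2 hc3) hc1
    (hc2.union hc3)
  · by_cases hY : Nonempty Y
    · obtain ⟨y0⟩ := hY
      have : ContinuousOn (fun w => jm (p w, y0, (0 : I))) (S ∩ {w | τ w ≤ 1 / 3}) := by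
        refine continuous_jm.comp_continuousOn (ContinuousOn.prodMk (hp.mono ?_)
          continuousOn_const)
        rintro w ⟨h1, h2⟩
        exact ⟨h1, le_trans (b := (1 / 3 : ℝ)) h2 (by norm_num)⟩
      refine this.congr fun w hw => ?_
      simp only
      rw [phi_zero hw.2]
      exact jm_zero _ _ _
    · intro w
      exact absurd ⟨q w⟩ hY
  · refine continuous_jm.comp_continuousOn ((hp.mono ?_).prodMk ((hq.mono ?_).prodMk
      (continuous_phi.comp_continuousOn (hτ.mono inter_subset_left))))
    · rintro w ⟨h1, h2⟩
      exact ⟨h1, h2.2⟩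
    · rintro w ⟨h1, h2⟩
      exact ⟨h1, h2.1⟩
  · by_cases hX : Nonempty X
    · obtain ⟨x0⟩ := hX
      have : ContinuousOn (fun w => jm (x0, q w, (1 : I))) (S ∩ {w | 2 / 3 ≤ τ w}) := by
        refine continuous_jm.comp_continuousOn (ContinuousOn.prodMk continuousOn_const
          (ContinuousOn.prodMk (hq.mono ?_) continuousOn_const))
        rintro w ⟨h1, h2⟩
        exact ⟨h1, le_trans (b := (2 / 3 : ℝ)) (by norm_num) h2⟩
      refine this.congr fun w hw => ?_
      simp only
      rw [phi_one hw.2]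
      exact jm_one _ _ _
    · intro w
      exact absurd ⟨p w⟩ hX

/-- Straight-line reparametrization of the join parameter. -/
noncomputable def mixI (u : I) (t : I) : I :=
  Set.projIcc 0 1 zero_le_one ((u : ℝ) * t + (1 - u) * (phi t : ℝ))

lemma continuous_mixI : Continuous fun a : I × I => mixI a.1 a.2 := by
  refine continuous_projIcc.comp ?_
  have := continuous_phi
  fun_prop

lemma mixI_one (t : I) : mixI 1 t = t := by
  simp [mixI]

lemma mixI_zero (t : I) : mixI 0 t = phi t := by
  simp [mixI]

lemma mixI_t0 (u : I) : mixI u 0 = 0 := by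
  have : phi ((0 : I) : ℝ) = 0 := phi_zero (by norm_num)
  rw [mixI, this]; simp

lemma mixI_t1 (u : I) : mixI u 1 = 1 := by
  have : phi ((1 : I) : ℝ) = 1 := phi_one (by norm_num)
  rw [mixI, this]; simp

/-- The reparametrization homotopy on the join. -/
lemma exists_reparam [Nonempty X] [Nonempty Y] :
    ∃ Φ : TopJoin X Y × I → TopJoin X Y, Continuous Φ ∧ (∀ z, Φ (z, 1) = z) ∧
      ∀ z, Φ (z, 0) = jm (jX z, jY z, phi (jt z)) := by
  let F : C((X × Y × I) × I, TopJoin X Y) :=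
    ⟨fun a => jm (a.1.1, a.1.2.1, mixI a.2 a.1.2.2), by
      refine continuous_jm.comp ?_
      have h : Continuous fun a : (X × Y × I) × I => mixI a.2 a.1.2.2 :=
        continuous_mixI.comp (f := fun a : (X × Y × I) × I => (a.2, a.1.2.2)) (by fun_prop)
      fun_prop⟩
  let K : TopJoin X Y → C(I, TopJoin X Y) := Quot.lift F.curry (by
    rintro ⟨x, y, t⟩ ⟨x', y', t'⟩ (h | h | h)
    · rw [h]
    · obtain ⟨h1, h2, h3⟩ := h
      simp only at h1 h2 h3
      subst h1 h2 h3
      ext u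
      change jm (x, y, mixI u 0) = jm (x, y', mixI u 0)
      rw [mixI_t0]
      exact jm_zero _ _ _
    · obtain ⟨h1, h2, h3⟩ := h
      simp only at h1 h2 h3
      subst h1 h2 h3
      ext u
      change jm (x, y, mixI u 1) = jm (x', y, mixI u 1)
      rw [mixI_t1]
      exact jm_one _ _ _)
  have hK : Continuous K := isQuotientMap_jm.continuous_iff.2 F.curry.continuous
  have hval : ∀ z u, K z u = jm (jX z, jY z, mixI u (jt z)) := by
    intro z u
    conv_lhs => rw [← jm_coords z]
    rfl
  refine ⟨Function.uncurry fun z u => K z u,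
    ContinuousMap.continuous_uncurry_of_continuous ⟨K, hK⟩, fun z => ?_, fun z => ?_⟩
  · simp only [Function.uncurry]
    rw [hval, mixI_one, jm_coords]
  · simp only [Function.uncurry]
    rw [hval, mixI_zero]

end join

lemma extProp_join {X Y : Type*} [TopologicalSpace X] [TopologicalSpace Y] [Nonempty X]
    [Nonempty Y] {ι : Type*} [Fintype ι] {k m : ℕ}
    (hX : ∀ P : ι → Prop, ∀ _ : Fintype {i // P i}, 1 ≤ Fintype.card {i // P i} →
      Fintype.card {i // P i} ≤ k → ExtProp ({i // P i} → ℝ) X)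
    (hY : ∀ P : ι → Prop, ∀ _ : Fintype {i // P i}, 1 ≤ Fintype.card {i // P i} →
      Fintype.card {i // P i} ≤ m → ExtProp ({i // P i} → ℝ) Y)
    (hn : Fintype.card ι ≤ k + m + 1) : ExtProp (ι → ℝ) (TopJoin X Y) := by
  intro f hf
  let fh : (ι → ℝ) → TopJoin X Y := fun x => f (‖x‖⁻¹ • x)
  have hfh : ContinuousOn fh {x | 0 < ‖x‖} := by
    have hc : ContinuousOn (fun x : ι → ℝ => ‖x‖⁻¹ • x) {x | 0 < ‖x‖} :=
      ContinuousOn.smul (ContinuousOn.inv₀ continuous_norm.continuousOn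
        fun x hx => ne_of_gt hx) continuousOn_id
    refine hf.comp hc ?_
    · intro x hx
      have : ‖x‖ ≠ 0 := ne_of_gt hx
      rw [mem_sphere_zero_iff_norm, norm_smul, norm_inv, norm_norm, inv_mul_cancel₀ this]
  have hfh_smul : ∀ (c : ℝ) (x : ι → ℝ), 0 < c → fh (c • x) = fh x := by
    intro c x hc
    simp only [fh]
    rw [norm_smul, Real.norm_of_nonneg hc.le, smul_smul]
    congr 2
    field_simp
  have hfh_sphere : ∀ x ∈ sphere (0 : ι → ℝ) 1, fh x = f x := by
    intro x hx
    rw [mem_sphere_zero_iff_norm] at hx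
    simp only [fh, hx]
    simp
  -- extend the join parameter
  have hjt : Continuous fun z : TopJoin X Y => (jt z : ℝ) := continuous_subtype_val.comp continuous_jt
  obtain ⟨T, hT⟩ : ∃ T : C(ι → ℝ, ℝ), ∀ x, 1 ≤ ‖x‖ → T x = jt (fh x) := by
    have hcl : IsClosed {x : ι → ℝ | 1 ≤ ‖x‖} := isClosed_le continuous_const continuous_norm
    have hc : ContinuousOn (fun x => (jt (fh x) : ℝ)) {x : ι → ℝ | 1 ≤ ‖x‖} :=
      hjt.comp_continuousOn (hfh.mono fun x (hx : 1 ≤ ‖x‖) =>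
        (lt_of_lt_of_le one_pos hx : 0 < ‖x‖))
    obtain ⟨T, hT⟩ := ContinuousMap.exists_restrict_eq hcl
      (⟨fun x => (jt (fh x) : ℝ), by
        rw [continuousOn_iff_continuous_domRestrict] at hc; exact hc⟩ :
        C({x : ι → ℝ | 1 ≤ ‖x‖}, ℝ))
    refine ⟨T, fun x hx => ?_⟩
    have := DFunLike.congr_fun hT ⟨x, hx⟩
    exact this
  obtain ⟨δ, hδ, huc⟩ : ∃ δ > 0, ∀ x ∈ closedBall (0 : ι → ℝ) 4, ∀ y ∈ closedBall (0 : ι → ℝ) 4,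
      dist x y < δ → dist (T x) (T y) < 1 / 6 :=
    Metric.uniformContinuousOn_iff.1
      ((isCompact_closedBall (0 : ι → ℝ) 4).uniformContinuousOn_of_continuous
        T.continuous.continuousOn) (1 / 6) (by norm_num)
  obtain ⟨N, hN5, hNδ⟩ : ∃ N : ℝ, 5 ≤ N ∧ 2 / N < δ := by
    refine ⟨max 5 (3 / δ), le_max_left _ _, ?_⟩
    have h1 : 3 / δ ≤ max 5 (3 / δ) := le_max_right _ _
    have h2 : 0 < max 5 (3 / δ) := lt_of_lt_of_le (by norm_num) (le_max_left _ _)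
    rw [div_lt_iff₀ h2]
    rw [div_le_iff₀ hδ] at h1
    linarith
  have hN0 : 0 < N := by linarith
  have hTf : ∀ z, N ≤ ‖z‖ → T (N⁻¹ • z) = jt (fh z) := by
    intro z hz
    rw [hT, hfh_smul _ _ (inv_pos.2 hN0)]
    rw [norm_smul, norm_inv, Real.norm_of_nonneg hN0.le, ← div_eq_inv_mul, le_div_iff₀ hN0]
    linarith
  have hnear : ∀ x z : ι → ℝ, ‖z - x‖ ≤ 2 → ‖x‖ - 2 ≤ ‖z‖ ∧ ‖z‖ ≤ ‖x‖ + 2 := by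
    intro x z h
    have h1 := norm_le_norm_add_norm_sub' x z
    have h2 := norm_le_norm_add_norm_sub' z x
    rw [norm_sub_rev] at h1
    constructor <;> linarith
  have hclose : ∀ x z : ι → ℝ, ‖z - x‖ ≤ 2 → 2 * N ≤ ‖x‖ → ‖x‖ ≤ 3 * N →
      N ≤ ‖z‖ ∧ ‖z‖ ≤ 4 * N ∧ |T (N⁻¹ • z) - T (N⁻¹ • x)| < 1 / 6 := by
    intro x z h h2 h3
    obtain ⟨e1, e2⟩ := hnear x z h
    refine ⟨by linarith, by linarith, ?_⟩
    have hb : ∀ w : ι → ℝ, ‖w‖ ≤ 4 * N → N⁻¹ • w ∈ closedBall (0 : ι → ℝ) 4 := by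
      intro w hw
      rw [mem_closedBall_zero_iff, norm_smul, norm_inv, Real.norm_of_nonneg hN0.le,
        ← div_eq_inv_mul, div_le_iff₀ hN0]
      exact hw
    have := huc _ (hb z (by linarith)) _ (hb x (by linarith)) (by
      rw [dist_eq_norm, ← smul_sub, norm_smul, norm_inv, Real.norm_of_nonneg hN0.le,
        ← div_eq_inv_mul]
      refine lt_of_le_of_lt ?_ hNδ
      gcongr)
    rwa [Real.dist_eq] at this
  -- extend the two coordinate maps
  let GA : Set (ι → ℝ) := {z | N ≤ ‖z‖ ∧ ‖z‖ ≤ 4 * N ∧ T (N⁻¹ • z) ≤ 5 / 6}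
  let GB : Set (ι → ℝ) := {z | N ≤ ‖z - hshift‖ ∧ ‖z - hshift‖ ≤ 4 * N ∧
    1 / 6 ≤ T (N⁻¹ • (z - hshift))}
  have hhs : ‖(hshift : ι → ℝ)‖ ≤ 1 := by
    rw [pi_norm_le_iff_of_nonneg zero_le_one]
    intro i
    simp only [hshift]
    norm_num
  have hcA : ∀ z, N ≤ ‖z‖ → T (N⁻¹ • z) ≤ 5 / 6 → jt (fh z) ≠ 1 := by
    intro z h1 h2 h3
    rw [hTf z h1, h3] at h2
    norm_num at h2
  have hcB : ∀ z, N ≤ ‖z‖ → 1 / 6 ≤ T (N⁻¹ • z) → jt (fh z) ≠ 0 := by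
    intro z h1 h2 h3
    rw [hTf z h1, h3] at h2
    norm_num at h2
  obtain ⟨P, hP, hPe⟩ := extend_skeleton (R := 5 * N) hX GA (by
      intro z hz
      rw [mem_closedBall_zero_iff]
      linarith [hz.2.1]) (fun z => jX (fh z))
    (continuousOn_jX.comp (hfh.mono fun z hz => lt_of_lt_of_le hN0 hz.1)
      fun z hz => hcA z hz.1 hz.2.2)
  obtain ⟨Q, hQ, hQe⟩ := extend_skeleton (R := 5 * N) hY GB (by
      intro z hz
      rw [mem_closedBall_zero_iff]
      have h1 := norm_le_norm_add_norm_sub' z hshift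
      linarith [hz.2.1]) (fun z => jY (fh (z - hshift)))
    (continuousOn_jY.comp (hfh.comp (by fun_prop) fun z hz => lt_of_lt_of_le hN0 hz.1)
      fun z hz => hcB _ hz.1 hz.2.2)
  have hrA : ∀ x : ι → ℝ, ∀ z ∈ gcell (rho x), ‖z - x‖ ≤ 2 := by
    intro x z hz
    have h1 := norm_sub_le_of_mem_gcell hz
    have h2 := norm_rho_sub_le x
    have h3 := norm_sub_le_norm_sub_add_norm_sub z (rho x) x
    linarith
  have hrB : ∀ x : ι → ℝ, ∀ z ∈ gcell (rho (x + hshift)), ‖z - hshift - x‖ ≤ 2 := by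
    intro x z hz
    have := hrA (x + hshift) z hz
    rwa [sub_sub, add_comm hshift x]
  have hGA : ∀ x : ι → ℝ, 2 * N ≤ ‖x‖ → ‖x‖ ≤ 3 * N → T (N⁻¹ • x) ≤ 2 / 3 →
      gcell (rho x) ⊆ GA := by
    intro x h1 h2 h3 z hz
    obtain ⟨e1, e2, e3⟩ := hclose x z (hrA x z hz) h1 h2
    rw [abs_lt] at e3
    exact ⟨e1, e2, by linarith⟩
  have hGB : ∀ x : ι → ℝ, 2 * N ≤ ‖x‖ → ‖x‖ ≤ 3 * N → 1 / 3 ≤ T (N⁻¹ • x) →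
      gcell (rho (x + hshift)) ⊆ GB := by
    intro x h1 h2 h3 z hz
    obtain ⟨e1, e2, e3⟩ := hclose x (z - hshift) (hrB x z hz) h1 h2
    rw [abs_lt] at e3
    exact ⟨e1, e2, by linarith⟩
  -- the new join parameter
  obtain ⟨sg₀, hsg₀, hsgA, hsgB⟩ := exists_sep (ι := ι) hn
  let s : (ι → ℝ) → ℝ := fun x => max 0 (min 1 (‖x‖ / N - 2))
  have hs : Continuous s := by
    simp only [s]
    fun_prop
  have hs0 : ∀ x, 0 ≤ s x := fun x => le_max_left _ _
  have hs1 : ∀ x, s x ≤ 1 := fun x => max_le (by norm_num) (min_le_left _ _)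
  have hsN : ∀ x, s x = 0 ∨ 2 * N ≤ ‖x‖ := by
    intro x
    by_cases h : 2 * N ≤ ‖x‖
    · exact Or.inr h
    · left
      push Not at h
      have : ‖x‖ / N < 2 := by rwa [div_lt_iff₀ hN0]
      exact max_eq_left ((min_le_right _ _).trans (by linarith))
  have hs3 : ∀ x, ‖x‖ = 3 * N → s x = 1 := by
    intro x hx
    simp only [s]
    rw [hx, mul_div_assoc, div_self hN0.ne']
    norm_num
  let sg : (ι → ℝ) → ℝ := fun x => (1 - s x) * sg₀ x + s x * T (N⁻¹ • x)
  have hsg : Continuous sg := by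
    have := T.continuous
    simp only [sg]
    fun_prop
  have hmemA : ∀ x, ‖x‖ ≤ 3 * N → sg x ≤ 2 / 3 →
      rho x ∈ {y | gcell y ⊆ GA} ∪ {y | gdim y ≤ k ∧ gcell y ⊆ closedBall 0 (5 * N)} := by
    intro x hx hsgx
    rcases hsgA x with h | h
    · left
      have hT23 : 2 * N ≤ ‖x‖ ∧ T (N⁻¹ • x) ≤ 2 / 3 := by
        rcases hsN x with h0 | h0
        · simp only [sg, h0] at hsgx
          linarith
        · refine ⟨h0, ?_⟩
          by_contra hc
          push Not at hc
          have a1 := hs0 x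
          have a2 := hs1 x
          simp only [sg] at hsgx
          nlinarith [mul_nonneg a1 (sub_nonneg.2 hc.le), mul_nonneg (sub_nonneg.2 a2) (sub_nonneg.2 h.le)]
      exact hGA x hT23.1 hx hT23.2
    · right
      refine ⟨h, fun z hz => ?_⟩
      have := hnear x z (hrA x z hz)
      rw [mem_closedBall_zero_iff]
      linarith
  have hmemB : ∀ x, ‖x‖ ≤ 3 * N → 1 / 3 ≤ sg x → rho (x + hshift) ∈
      {y | gcell y ⊆ GB} ∪ {y | gdim y ≤ m ∧ gcell y ⊆ closedBall 0 (5 * N)} := by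
    intro x hx hsgx
    rcases hsgB x with h | h
    · left
      have hT13 : 2 * N ≤ ‖x‖ ∧ 1 / 3 ≤ T (N⁻¹ • x) := by
        rcases hsN x with h0 | h0
        · simp only [sg, h0] at hsgx
          linarith
        · refine ⟨h0, ?_⟩
          by_contra hc
          push Not at hc
          have a1 := hs0 x
          have a2 := hs1 x
          simp only [sg] at hsgx
          nlinarith [mul_nonneg a1 (sub_nonneg.2 hc.le), mul_nonneg (sub_nonneg.2 a2) (sub_nonneg.2 h.le)]
      exact hGB x hT13.1 hx hT13.2
    · right
      refine ⟨h, fun z hz => ?_⟩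
      have h1 := hnear x _ (hrB x z hz)
      have h2 := norm_le_norm_add_norm_sub' z hshift
      rw [mem_closedBall_zero_iff]
      linarith
  let g : (ι → ℝ) → TopJoin X Y := fun x => jm (P (rho x), Q (rho (x + hshift)), phi (sg x))
  have hg : ContinuousOn g (closedBall 0 (3 * N)) := by
    refine continuousOn_glue isClosed_closedBall sg hsg.continuousOn _ _ ?_ ?_
    · refine hP.comp continuous_rho.continuousOn ?_
      rintro x ⟨h1, h2⟩
      exact hmemA x (mem_closedBall_zero_iff.1 h1) h2
    · refine hQ.comp (continuous_rho.comp (by fun_prop)).continuousOn ?_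
      rintro x ⟨h1, h2⟩
      exact hmemB x (mem_closedBall_zero_iff.1 h1) h2
  -- second homotopy
  let c : ℝ := 3 * N
  have hc0 : 0 < c := by simp only [c]; linarith
  let mvA : (ι → ℝ) × ℝ → (ι → ℝ) := fun a => c • a.1 + (1 - a.2) • (rho (c • a.1) - c • a.1)
  let mvB : (ι → ℝ) × ℝ → (ι → ℝ) := fun a =>
    c • a.1 + (1 - a.2) • (rho (c • a.1 + hshift) - hshift - c • a.1)
  have hmvA : Continuous mvA := by
    have := continuous_rho (ι := ι)
    simp only [mvA]
    fun_prop
  have hmvB : Continuous mvB := by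
    have := continuous_rho (ι := ι)
    simp only [mvB]
    fun_prop
  have hcx : ∀ x ∈ sphere (0 : ι → ℝ) 1, ‖c • x‖ = 3 * N := by
    intro x hx
    rw [mem_sphere_zero_iff_norm] at hx
    rw [norm_smul, hx, Real.norm_of_nonneg hc0.le, mul_one]
  have hTc : ∀ x ∈ sphere (0 : ι → ℝ) 1, T (N⁻¹ • c • x) = jt (f x) := by
    intro x hx
    rw [hTf _ (by rw [hcx x hx]; linarith), hfh_smul _ _ hc0, hfh_sphere x hx]
  have hconv : ∀ (u : ℝ) (w : ι → ℝ), 0 ≤ u → u ≤ 1 → ‖w‖ ≤ 2 → ‖(1 - u) • w‖ ≤ 2 := by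
    intro u w h0 h1 h2
    rw [norm_smul, Real.norm_of_nonneg (by linarith)]
    nlinarith [norm_nonneg w]
  have hmvA2 : ∀ a ∈ sphere (0 : ι → ℝ) 1 ×ˢ Icc (0 : ℝ) 1, ‖mvA a - c • a.1‖ ≤ 2 := by
    intro a ha
    simp only [mvA]
    rw [add_sub_cancel_left]
    exact hconv _ _ ha.2.1 ha.2.2 (hrA _ _ (mem_gcell_self _))
  have hmvB2 : ∀ a ∈ sphere (0 : ι → ℝ) 1 ×ˢ Icc (0 : ℝ) 1, ‖mvB a - c • a.1‖ ≤ 2 := by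
    intro a ha
    simp only [mvB]
    rw [add_sub_cancel_left]
    exact hconv _ _ ha.2.1 ha.2.2 (hrB _ _ (mem_gcell_self _))
  let H : (ι → ℝ) × ℝ → TopJoin X Y := fun a =>
    jm (jX (fh (mvA a)), jY (fh (mvB a)), phi (jt (f a.1)))
  have hSc : IsClosed (sphere (0 : ι → ℝ) 1 ×ˢ Icc (0 : ℝ) 1) := isClosed_sphere.prod isClosed_Icc
  have hH : ContinuousOn H (sphere 0 1 ×ˢ Icc 0 1) := by
    refine continuousOn_glue hSc (fun a => (jt (f a.1) : ℝ))
      (hjt.comp_continuousOn (hf.comp continuousOn_fst fun a ha => ha.1)) _ _ ?_ ?_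
    · refine continuousOn_jX.comp (hfh.comp hmvA.continuousOn ?_) ?_
      · rintro a ⟨ha, -⟩
        exact lt_of_lt_of_le hN0 (hclose _ _ (hmvA2 a ha) (by rw [hcx _ ha.1]; linarith)
          (hcx _ ha.1).le).1
      · rintro a ⟨ha, hle⟩
        obtain ⟨b1, -, b3⟩ := hclose _ _ (hmvA2 a ha) (by rw [hcx _ ha.1]; linarith)
          (hcx _ ha.1).le
        rw [hTc _ ha.1, abs_lt] at b3
        have hle' : (jt (f a.1) : ℝ) ≤ 2 / 3 := hle
        exact hcA _ b1 (by linarith)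
    · refine continuousOn_jY.comp (hfh.comp hmvB.continuousOn ?_) ?_
      · rintro a ⟨ha, -⟩
        exact lt_of_lt_of_le hN0 (hclose _ _ (hmvB2 a ha) (by rw [hcx _ ha.1]; linarith)
          (hcx _ ha.1).le).1
      · rintro a ⟨ha, hle⟩
        obtain ⟨b1, -, b3⟩ := hclose _ _ (hmvB2 a ha) (by rw [hcx _ ha.1]; linarith)
          (hcx _ ha.1).le
        rw [hTc _ ha.1, abs_lt] at b3
        have hle' : 1 / 3 ≤ (jt (f a.1) : ℝ) := hle
        exact hcB _ b1 (by linarith)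
  obtain ⟨Φ, hΦ, hΦ1, hΦ0⟩ := exists_reparam (X := X) (Y := Y)
  have key := extend_of_homotopy H hH ⟨fun x => g (c • x), ?_, ?_⟩
  · have key2 := extend_of_homotopy (fun a : (ι → ℝ) × ℝ => Φ (f a.1, projIcc 0 1 zero_le_one a.2))
      (hΦ.comp_continuousOn ((hf.comp continuousOn_fst fun a ha => ha.1).prodMk
        (continuous_projIcc.comp continuous_snd).continuousOn)) ?_
    · obtain ⟨p, hp, hpe⟩ := key2
      refine ⟨p, hp, fun x hx => ?_⟩
      rw [hpe x hx]
      simp only [projIcc_right]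
      exact hΦ1 _
    · obtain ⟨p, hp, hpe⟩ := key
      refine ⟨p, hp, fun x hx => ?_⟩
      rw [hpe x hx]
      simp only [projIcc_left]
      refine Eq.trans ?_ (hΦ0 _).symm
      simp only [H, mvA, mvB, sub_self, zero_smul, add_zero]
      rw [hfh_smul _ _ hc0, hfh_sphere x hx]
  · refine hg.comp (by fun_prop) fun x hx => ?_
    rw [mem_closedBall_zero_iff] at hx ⊢
    rw [norm_smul, Real.norm_of_nonneg hc0.le]
    nlinarith
  · intro x hx
    have e1 := hcx x hx
    have e2 := hTc x hx
    have e3 : sg (c • x) = jt (f x) := by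
      simp only [sg]
      rw [hs3 _ e1, e2]
      ring
    simp only [g, H, e3, mvA, mvB, sub_zero, one_smul, add_sub_cancel]
    refine jm_phi_congr (fun h => ?_) (fun h => ?_)
    · exact hPe (hGA _ (by rw [e1]; linarith) e1.le (by rw [e2]; exact h))
    · exact hQe (hGB _ (by rw [e1]; linarith) e1.le (by rw [e2]; exact h))

/-- conn(X * Y) ≥ conn(X) + conn(Y) + 2: if `X` is `a`-connected and `Y` is
`b`-connected, then the join `X * Y` is `(a + b + 2)`-connected. -/
theorem conn_join (X Y : Type*) [TopologicalSpace X] [TopologicalSpace Y]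
    (a b : ℤ) (ha : -1 ≤ a) (hb : -1 ≤ b)
    (hX : IsKConnected X a) (hY : IsKConnected Y b) :
    IsKConnected (TopJoin X Y) (a + b + 2) := by
  have : Nonempty X := hX.1 ha
  have : Nonempty Y := hY.1 hb
  have : Nonempty (TopJoin X Y) :=
    ⟨jm (Classical.arbitrary X, Classical.arbitrary Y, 0)⟩
  refine isKConnected_of_extProp fun l hl => ?_
  refine extProp_join (k := (a + 1).toNat) (m := (b + 1).toNat) ?_ ?_ ?_
  · intro P _ h1 h2
    exact hX.extProp h1 (by omega)
  · intro P _ h1 h2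
    exact hY.extProp h1 (by omega)
  · rw [Fintype.card_fin]
    omega
end

section
/- The chessboard complex Δ_{m,n} is (ν − 2)-connected, where ν = min{m, n, ⌊(m + n + 1)/3⌋}. -/
open Metric

/-- The geometric realization of the chessboard complex Δ_{m,n} on vertex set
[n] × [m]: convex-combination weight functions whose support is a set of
pairwise non-attacking rooks. -/
def ChessRealization (m n : ℕ) : Set ((Fin n × Fin m) → ℝ) :=
  {w | (∀ v, 0 ≤ w v) ∧ (∑ v, w v = 1) ∧
    ∀ p q : Fin n × Fin m, w p ≠ 0 → w q ≠ 0 → p ≠ q → p.1 ≠ q.1 ∧ p.2 ≠ q.2}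

/-- Realization of the independence complex of `G` restricted to `W`. -/
def Rl {V : Type*} [Fintype V] (G : SimpleGraph V) (W : Set V) : Set (V → ℝ) :=
  {w | (∀ v, 0 ≤ w v) ∧ (∑ v, w v = 1) ∧ (∀ v, v ∉ W → w v = 0) ∧
    ∀ p q, w p ≠ 0 → w q ≠ 0 → ¬ G.Adj p q}

/-- number of coordinates of `x` in `S`. -/
noncomputable def cnt {N : ℕ} (S : Set ℝ) (x : Fin N → ℝ) : ℕ :=
  by classical exact (Finset.univ.filter (fun i => x i ∈ S)).card

/-- extension property for maps from compacta of dimension `≤ ν - 1`. -/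
def RookExt {V : Type*} [Fintype V] (G : SimpleGraph V) (N : ℕ) (W : Set V) (ν : ℕ) : Prop :=
  ∀ X : Set (Fin N → ℝ), IsCompact X →
    (∃ S : Set ℝ, S.Countable ∧ ∀ x ∈ X, N + 1 ≤ cnt S x + ν) →
    ∀ B ⊆ X, IsClosed B → ∀ f : (Fin N → ℝ) → (V → ℝ), ContinuousOn f B →
      (∀ x ∈ B, f x ∈ Rl G W) →
      ∃ g : (Fin N → ℝ) → (V → ℝ), ContinuousOn g X ∧ (∀ x ∈ X, g x ∈ Rl G W) ∧
        ∀ x ∈ B, g x = f x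

theorem cnt_le {N : ℕ} (S : Set ℝ) (x : Fin N → ℝ) : cnt S x ≤ N := by
  classical
  unfold cnt
  exact (Finset.card_le_univ _).trans (by simp)

theorem tietze {N : ℕ} {V : Type*} [Fintype V] {B : Set (Fin N → ℝ)} (hB : IsClosed B)
    (f : (Fin N → ℝ) → (V → ℝ)) (hf : ContinuousOn f B) :
    ∃ F : (Fin N → ℝ) → (V → ℝ), Continuous F ∧ ∀ x ∈ B, F x = f x := by
  obtain ⟨g, hg⟩ := ContinuousMap.exists_restrict_eq hB
    (⟨B.domRestrict f, continuousOn_iff_continuous_domRestrict.1 hf⟩ : C(B, V → ℝ))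
  refine ⟨g, g.continuous, fun x hx => ?_⟩
  have := congrArg (fun h : C(B, V → ℝ) => h ⟨x, hx⟩) hg
  exact this

/-- A continuous clean-up to independent support. -/
theorem cleanup {V : Type*} [Fintype V] (G : SimpleGraph V) (W : Set V) :
    ∃ M : (V → ℝ) → (V → ℝ), Continuous M ∧ (∀ w v, 0 ≤ M w v) ∧ (∀ w v, v ∉ W → M w v = 0) ∧
      (∀ w p q, M w p ≠ 0 → M w q ≠ 0 → ¬ G.Adj p q) ∧ ∀ w ∈ Rl G W, M w = w := by
  classical
  let H : (V → ℝ) → V → ℝ := fun w v => if v ∈ W then max 0 (w v) else 0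
  have hH : Continuous H := by
    refine continuous_pi fun v => ?_
    by_cases hv : v ∈ W
    · simp only [H, hv, if_true]; fun_prop
    · simp only [H, hv, if_false]; fun_prop
  have hH0 : ∀ w v, 0 ≤ H w v := fun w v => by
    simp only [H]; split_ifs
    · exact le_max_left _ _
    · exact le_rfl
  -- use a sum rather than a supremum
  let c : (V → ℝ) → ℝ := fun w => ∑ p, ∑ q, if G.Adj p q then min (H w p) (H w q) else 0
  have hc : Continuous c := by
    refine continuous_finsetSum _ fun p _ => continuous_finsetSum _ fun q _ => ?_
    split_ifs <;> fun_prop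
  have hterm : ∀ w p q, 0 ≤ if G.Adj p q then min (H w p) (H w q) else 0 := fun w p q => by
    split_ifs
    · exact le_min (hH0 _ _) (hH0 _ _)
    · exact le_rfl
  have hc0 : ∀ w, 0 ≤ c w := fun w =>
    Finset.sum_nonneg fun p _ => Finset.sum_nonneg fun q _ => hterm w p q
  have hcl : ∀ w p q, G.Adj p q → min (H w p) (H w q) ≤ c w := fun w p q h => by
    have h1 := Finset.single_le_sum (f := fun q => if G.Adj p q then min (H w p) (H w q) else 0)
      (fun q _ => hterm w p q) (Finset.mem_univ q)
    have h2 := Finset.single_le_sum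
      (f := fun p => ∑ q, if G.Adj p q then min (H w p) (H w q) else 0)
      (fun p _ => Finset.sum_nonneg fun q _ => hterm w p q) (Finset.mem_univ p)
    simp only [h, if_true] at h1
    exact h1.trans h2
  refine ⟨fun w v => max 0 (H w v - c w), ?_, ?_, ?_, ?_, ?_⟩
  · refine continuous_pi fun v => ?_
    fun_prop
  · intro w v; exact le_max_left _ _
  · intro w v hv
    have : H w v = 0 := by simp [H, hv]
    simp only [this]
    exact max_eq_left (by linarith [hc0 w])
  · intro w p q hp hq h
    have hp' : c w < H w p := by
      by_contra h'; exact hp (max_eq_left (by linarith))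
    have hq' : c w < H w q := by
      by_contra h'; exact hq (max_eq_left (by linarith))
    exact absurd (hcl w p q h) (not_le.2 (lt_min hp' hq'))
  · rintro w ⟨h0, h1, h2, h3⟩
    have hHw : H w = w := by
      funext v
      by_cases hv : v ∈ W
      · simp [H, hv, h0 v]
      · simp [H, hv, h2 v hv]
    have hcw : c w = 0 := by
      refine Finset.sum_eq_zero fun p _ => Finset.sum_eq_zero fun q _ => ?_
      split_ifs with h
      · rw [hHw]
        by_cases hp : w p = 0
        · rw [hp]; exact min_eq_left (h0 q)
        · by_cases hq : w q = 0
          · rw [hq]; exact min_eq_right (h0 p)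
          · exact absurd h (h3 p q hp hq)
      · rfl
    funext v
    simp [hHw, hcw, h0 v]

theorem sum_split {V : Type*} [Fintype V] [DecidableEq V] (v : V) (a : ℝ) (h : V → ℝ) :
    (∑ u, if u = v then a else h u) = a + ∑ u ∈ Finset.univ.erase v, h u := by
  rw [← Finset.add_sum_erase _ _ (Finset.mem_univ v)]
  simp only [if_true]
  congr 1
  refine Finset.sum_congr rfl fun u hu => ?_
  simp [(Finset.mem_erase.1 hu).1]

/-- Cones are extensors. -/
theorem cone_ext {V : Type*} [Fintype V] (G : SimpleGraph V) {N : ℕ} (W : Set V) (v : V)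
    (hv : v ∈ W) (hiso : ∀ u ∈ W, ¬ G.Adj v u) (B : Set (Fin N → ℝ)) (hB : IsClosed B)
    (f : (Fin N → ℝ) → (V → ℝ)) (hf : ContinuousOn f B) (hfW : ∀ x ∈ B, f x ∈ Rl G W) :
      ∃ g : (Fin N → ℝ) → (V → ℝ), Continuous g ∧ (∀ x, g x ∈ Rl G W) ∧
        ∀ x ∈ B, g x = f x := by
  classical
  obtain ⟨F, hF, hFB⟩ := tietze hB f hf
  obtain ⟨M, hM, hM0, hMW, hMi, hMr⟩ := cleanup G W
  let s : (Fin N → ℝ) → ℝ := fun x => ∑ u ∈ Finset.univ.erase v, M (F x) u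
  have hs : Continuous s := by fun_prop
  have hs0 : ∀ x, 0 ≤ s x := fun x => Finset.sum_nonneg fun u _ => hM0 _ _
  have hpos : ∀ x, 0 < max 1 (s x) := fun x => lt_of_lt_of_le one_pos (le_max_left _ _)
  refine ⟨fun x u => if u = v then 1 - s x / max 1 (s x) else M (F x) u / max 1 (s x),
    ?_, ?_, ?_⟩
  · refine continuous_pi fun u => ?_
    split_ifs
    · exact continuous_const.sub (hs.div (by fun_prop) fun x => (hpos x).ne')
    · exact Continuous.div (by fun_prop) (by fun_prop) fun x => (hpos x).ne'
  · intro x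
    refine ⟨fun u => ?_, ?_, fun u hu => ?_, fun p q hp hq => ?_⟩
    · dsimp only
      split_ifs
      · have : s x / max 1 (s x) ≤ 1 := (div_le_one (hpos x)).2 (le_max_right _ _)
        linarith
      · exact div_nonneg (hM0 _ _) (hpos x).le
    · rw [sum_split, ← Finset.sum_div]
      simp [s]
    · have : u ≠ v := fun h => hu (h ▸ hv)
      simp [this, hMW _ _ hu]
    · by_cases hpv : p = v
      · subst hpv
        by_cases hqW : q ∈ W
        · exact hiso q hqW
        · have : q ≠ p := fun h => hqW (h ▸ hv)
          simp [this, hMW _ _ hqW] at hq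
      · by_cases hqv : q = v
        · subst hqv
          by_cases hpW : p ∈ W
          · exact fun h => hiso p hpW h.symm
          · simp [hpv, hMW _ _ hpW] at hp
        · simp only [hpv, hqv, if_false] at hp hq
          exact hMi (F x) p q (fun h => hp (by rw [h, zero_div])) (fun h => hq (by rw [h, zero_div]))
  · intro x hx
    have h1 : M (F x) = f x := by rw [hFB x hx]; exact hMr _ (hfW x hx)
    obtain ⟨g0, g1, -, -⟩ := hfW x hx
    have h2 : f x v + s x = 1 := by
      rw [← g1, ← Finset.add_sum_erase _ _ (Finset.mem_univ v)]
      simp only [s, h1]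
    have h3 : max 1 (s x) = 1 := max_eq_left (by linarith [g0 v])
    funext u
    simp only [h3, h1, div_one]
    split_ifs with h
    · rw [h]; linarith
    · rfl

/-- Splitting along a lower dimensional partition. -/
theorem split {N : ℕ} (X : Set (Fin N → ℝ)) (hX : IsCompact X) (S : Set ℝ) (hS : S.Countable)
    (τ : (Fin N → ℝ) → ℝ) (hτ : Continuous τ) :
    ∃ X1 X2 : Set (Fin N → ℝ), IsClosed X1 ∧ IsClosed X2 ∧ X1 ∪ X2 = X ∧
      (∀ x ∈ X1, τ x ≤ 2/3) ∧ (∀ x ∈ X2, 1/3 ≤ τ x) ∧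
      ∃ S' : Set ℝ, S'.Countable ∧ ∀ x ∈ X1 ∩ X2, cnt S x + 1 ≤ cnt S' x := by
  classical
  have huc := hX.uniformContinuousOn_of_continuous hτ.continuousOn
  obtain ⟨δ, hδ, huc⟩ := Metric.uniformContinuousOn_iff.1 huc (1/6) (by norm_num)
  set ε := δ / 2 with hε
  have hε0 : 0 < ε := by positivity
  have hbad : (⋃ k : ℤ, (fun s => s / ε - k) '' S).Countable :=
    Set.countable_iUnion fun k => hS.image _
  obtain ⟨θ, hθ⟩ := (hbad.dense_compl ℝ).nonempty
  let S₂ : Set ℝ := Set.range fun k : ℤ => (k + θ) * ε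
  have hdisj : ∀ s ∈ S, s ∉ S₂ := by
    rintro s hs ⟨k, rfl⟩
    apply hθ
    refine Set.mem_iUnion.2 ⟨k, _, hs, ?_⟩
    simp only
    field_simp
    ring
  let φ : (Fin N → ℝ) → Fin N → ℤ := fun x i => ⌊x i / ε - θ⌋
  have hφ : ∀ x y, φ x = φ y → dist x y < δ := by
    intro x y h
    refine (dist_pi_lt_iff hδ).2 fun i => ?_
    have h1 : ⌊x i / ε - θ⌋ = ⌊y i / ε - θ⌋ := congrFun h i
    have h2 := Int.abs_sub_lt_one_of_floor_eq_floor h1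
    have h3 : x i / ε - θ - (y i / ε - θ) = (x i - y i) / ε := by ring
    rw [h3, abs_div, abs_of_pos hε0, div_lt_one hε0] at h2
    rw [Real.dist_eq]
    linarith
  let Y1 : Set (Fin N → ℝ) := {x ∈ X | ∃ y ∈ X, φ y = φ x ∧ τ y ≤ 1/2}
  let Y2 : Set (Fin N → ℝ) := {x ∈ X | ¬ ∃ y ∈ X, φ y = φ x ∧ τ y ≤ 1/2}
  have hY : Y1 ∪ Y2 = X := by
    ext x; simp only [Y1, Y2, Set.mem_union, Set.mem_ofPred_eq]; rw [← and_or_left]; simp only [em, and_true]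
  refine ⟨closure Y1, closure Y2, isClosed_closure, isClosed_closure, ?_, ?_, ?_,
    S ∪ S₂, hS.union (Set.countable_range _), ?_⟩
  · rw [← closure_union, hY, hX.isClosed.closure_eq]
  · intro x hx
    refine closure_minimal ?_ (isClosed_le hτ continuous_const) hx
    rintro z ⟨hz, y, hy, hyz, hyt⟩
    have := huc y hy z hz (hφ _ _ hyz)
    rw [Real.dist_eq, abs_lt] at this
    simp only [Set.mem_ofPred_eq]
    linarith
  · intro x hx
    refine closure_minimal ?_ (isClosed_le continuous_const hτ) hx
    rintro z ⟨hz, hz2⟩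
    have : ¬ τ z ≤ 1/2 := fun h => hz2 ⟨z, hz, rfl, h⟩
    simp only [Set.mem_ofPred_eq]
    linarith
  · rintro x ⟨hx1, hx2⟩
    have key : ∃ i, x i ∈ S₂ := by
      by_contra hno
      push Not at hno
      let O : Set (Fin N → ℝ) := ⋂ i, ({y | (φ x i : ℝ) < y i / ε - θ} ∩ {y | y i / ε - θ < φ x i + 1})
      have hO : IsOpen O := isOpen_iInter_of_finite fun i =>
        (isOpen_lt (by fun_prop) (by fun_prop)).inter (isOpen_lt (by fun_prop) (by fun_prop))
      have hxO : x ∈ O := by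
        refine Set.mem_iInter.2 fun i => ⟨lt_of_le_of_ne (Int.floor_le (x i / ε - θ)) fun h => ?_,
          Int.lt_floor_add_one (x i / ε - θ)⟩
        apply hno i
        refine ⟨φ x i, ?_⟩
        simp only
        rw [h]; field_simp; ring
      have hOφ : ∀ y ∈ O, φ y = φ x := by
        intro y hy
        funext i
        have := Set.mem_iInter.1 hy i
        exact Int.floor_eq_iff.2 ⟨this.1.le, this.2⟩
      obtain ⟨y1, hy1O, hy1, z, hz, hzy, hzt⟩ := mem_closure_iff.1 hx1 O hO hxO
      obtain ⟨y2, hy2O, hy2, hy2'⟩ := mem_closure_iff.1 hx2 O hO hxO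
      exact hy2' ⟨z, hz, by rw [hzy, hOφ _ hy1O, hOφ _ hy2O], hzt⟩
    obtain ⟨i, hi⟩ := key
    unfold cnt
    refine Finset.card_lt_card ⟨fun j hj => ?_, fun h => ?_⟩
    · simp only [Finset.mem_filter, Finset.mem_univ, true_and] at hj ⊢
      exact Or.inl hj
    · have := h (show i ∈ _ by
        simp only [Finset.mem_filter, Finset.mem_univ, true_and]; exact Or.inr hi)
      simp only [Finset.mem_filter, Finset.mem_univ, true_and] at this
      exact hdisj _ this hi

/-- removing the apex -/
theorem side_ext {V : Type*} [Fintype V] (G : SimpleGraph V) {N ν : ℕ} (W : Set V) (v : V)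
    (hv : v ∈ W) (hL : RookExt G N (W \ {v}) ν) (X : Set (Fin N → ℝ)) (hX : IsCompact X)
    (hdim : ∃ S : Set ℝ, S.Countable ∧ ∀ x ∈ X, N + 1 ≤ cnt S x + ν)
    (B : Set (Fin N → ℝ)) (hBX : B ⊆ X) (hB : IsClosed B)
    (f : (Fin N → ℝ) → (V → ℝ)) (hf : ContinuousOn f B) (hfW : ∀ x ∈ B, f x ∈ Rl G W)
    (hfv : ∀ x ∈ B, f x v ≤ 2/3) :
      ∃ g : (Fin N → ℝ) → (V → ℝ), ContinuousOn g X ∧ (∀ x ∈ X, g x ∈ Rl G W) ∧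
        ∀ x ∈ B, g x = f x := by
  classical
  obtain ⟨F, hF, hFB⟩ := tietze hB f hf
  obtain ⟨M, hM, hM0, hMW, hMi, hMr⟩ := cleanup G W
  have hMB : ∀ x ∈ B, M (F x) = f x := fun x hx => by
    rw [hFB x hx]; exact hMr _ (hfW x hx)
  let s : (Fin N → ℝ) → ℝ := fun x => ∑ u ∈ Finset.univ.erase v, M (F x) u
  have hs : Continuous s := by fun_prop
  have hsB : ∀ x ∈ B, f x v + s x = 1 := fun x hx => by
    rw [← (hfW x hx).2.1, ← Finset.add_sum_erase _ _ (Finset.mem_univ v)]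
    simp only [s, hMB x hx]
  let D : Set (Fin N → ℝ) := X ∩ {x | 1/6 ≤ s x}
  have hD : IsClosed D := hX.isClosed.inter (isClosed_le continuous_const hs)
  have hDpos : ∀ x ∈ D, 0 < s x := fun x hx => by
    have : 1/6 ≤ s x := hx.2
    linarith
  have hBD : B ⊆ D := fun x hx => ⟨hBX hx, by
    have := hsB x hx
    have := hfv x hx
    simp only [Set.mem_ofPred_eq]; linarith⟩
  let R : (Fin N → ℝ) → (V → ℝ) := fun x u => if u = v then 0 else M (F x) u / s x
  obtain ⟨g, hg, hgW, hgR⟩ := hL X hX hdim D Set.inter_subset_left hD R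
    (by
      refine continuousOn_pi.2 fun u => ?_
      simp only [R]
      split_ifs
      · exact continuousOn_const
      · exact ContinuousOn.div (by fun_prop) hs.continuousOn fun x hx => (hDpos x hx).ne')
    (by
      intro x hx
      have hp := hDpos x hx
      refine ⟨fun u => ?_, ?_, fun u hu => ?_, fun p q hp' hq' => ?_⟩
      · simp only [R]
        split_ifs
        · exact le_rfl
        · exact div_nonneg (hM0 _ _) hp.le
      · simp only [R]
        rw [sum_split, ← Finset.sum_div, zero_add]
        exact div_self hp.ne'
      · simp only [R]
        split_ifs with h
        · rfl
        · rw [hMW _ _ (fun h' => hu ⟨h', h⟩), zero_div]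
      · simp only [R] at hp' hq'
        refine hMi (F x) p q (fun h => hp' ?_) (fun h => hq' ?_) <;> simp [h])
  let μ : (Fin N → ℝ) → ℝ := fun x => max 0 (min 1 (6 * s x - 1)) * min (M (F x) v) 1
  have hμ : Continuous μ := by fun_prop
  have hμ0 : ∀ x, 0 ≤ μ x := fun x =>
    mul_nonneg (le_max_left _ _) (le_min (hM0 _ _) zero_le_one)
  have hμ1 : ∀ x, μ x ≤ 1 := fun x =>
    mul_le_one₀ (max_le zero_le_one (min_le_left _ _)) (le_min (hM0 _ _) zero_le_one)
      (min_le_right _ _)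
  have hμB : ∀ x ∈ B, μ x = f x v := by
    intro x hx
    have h1 := hsB x hx
    have h2 := hfv x hx
    have h3 := (hfW x hx).1 v
    have h4 : min 1 (6 * s x - 1) = 1 := min_eq_left (by linarith)
    simp only [μ, h4, hMB x hx]
    rw [max_eq_right zero_le_one, one_mul, min_eq_left (by linarith)]
  refine ⟨fun x u => if u = v then μ x else (1 - μ x) * g x u, ?_, ?_, ?_⟩
  · refine continuousOn_pi.2 fun u => ?_
    split_ifs
    · exact hμ.continuousOn
    · exact (continuousOn_const.sub hμ.continuousOn).mul (continuousOn_pi.1 hg u)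
  · intro x hx
    obtain ⟨g0, g1, g2, g3⟩ := hgW x hx
    have gv : g x v = 0 := g2 v (fun h => h.2 rfl)
    have hrel : μ x ≠ 0 → M (F x) v ≠ 0 ∧ ∀ u, u ≠ v → g x u ≠ 0 → M (F x) u ≠ 0 := by
      intro h
      have hMv : M (F x) v ≠ 0 := fun h' => h (by simp [μ, h'])
      refine ⟨hMv, fun u hu hgu hMu => ?_⟩
      have hxD : x ∈ D := by
        refine ⟨hx, ?_⟩
        by_contra h'
        simp only [Set.mem_ofPred_eq, not_le] at h'
        apply h
        have : max 0 (min 1 (6 * s x - 1)) = 0 :=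
          max_eq_left ((min_le_right _ _).trans (by linarith))
        simp only [μ, this, zero_mul]
      apply hgu
      rw [hgR x hxD]
      simp [R, hMu]
    refine ⟨fun u => ?_, ?_, fun u hu => ?_, fun p q hp hq => ?_⟩
    · dsimp only
      split_ifs
      · exact hμ0 x
      · exact mul_nonneg (by linarith [hμ1 x]) (g0 u)
    · rw [sum_split, ← Finset.mul_sum]
      rw [← Finset.add_sum_erase _ _ (Finset.mem_univ v), gv, zero_add] at g1
      rw [g1]; ring
    · have : u ≠ v := fun h => hu (h ▸ hv)
      simp [this, g2 u (fun h => hu h.1)]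
    · by_cases hpv : p = v
      · by_cases hqv : q = v
        · rw [hpv, hqv]; exact G.loopless.irrefl v
        · simp only [hpv, hqv, if_true, if_false] at hp hq
          have h := hrel hp
          rw [hpv]
          exact hMi (F x) v q h.1 (h.2 q hqv (right_ne_zero_of_mul hq))
      · by_cases hqv : q = v
        · simp only [hpv, hqv, if_true, if_false] at hp hq
          have h := hrel hq
          rw [hqv]
          exact hMi (F x) p v (h.2 p hpv (right_ne_zero_of_mul hp)) h.1
        · simp only [hpv, hqv, if_false] at hp hq
          exact g3 p q (right_ne_zero_of_mul hp) (right_ne_zero_of_mul hq)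
  · intro x hx
    have h1 := hsB x hx
    funext u
    simp only [hμB x hx]
    split_ifs with h
    · rw [h]
    · have hpos := hDpos x (hBD hx)
      rw [hgR x (hBD hx)]
      simp only [R, h, if_false, hMB x hx]
      have : 1 - f x v = s x := by linarith
      rw [this]; field_simp

theorem Rl_mono {V : Type*} [Fintype V] (G : SimpleGraph V) {W W' : Set V} (h : W ⊆ W') :
    Rl G W ⊆ Rl G W' := fun _ hw =>
  ⟨hw.1, hw.2.1, fun v hv => hw.2.2.1 v fun h' => hv (h h'), hw.2.2.2⟩

/-- The gluing step. -/
theorem glue {V : Type*} [Fintype V] (G : SimpleGraph V) {N ν : ℕ} (W : Set V) (v : V)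
    (hv : v ∈ W) (hL : RookExt G N (W \ {v}) (ν + 1))
    (hN : RookExt G N {u ∈ W | u ≠ v ∧ ¬ G.Adj v u} ν) : RookExt G N W (ν + 1) := by
  classical
  intro X hX hdim B hBX hB f hf hfW
  obtain ⟨S, hS, hSX⟩ := hdim
  obtain ⟨F, hF, hFB⟩ := tietze hB f hf
  let τ : (Fin N → ℝ) → ℝ := fun x => F x v
  have hτ : Continuous τ := by fun_prop
  have hτB : ∀ x ∈ B, τ x = f x v := fun x hx => by simp only [τ, hFB x hx]
  obtain ⟨X1, X2, hX1, hX2, hXU, hlo, hhi, S', hS', hP⟩ := split X hX S hS τ hτ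
  have hX1X : X1 ⊆ X := hXU ▸ Set.subset_union_left
  have hX2X : X2 ⊆ X := hXU ▸ Set.subset_union_right
  let P := X1 ∩ X2
  have hPc : IsClosed P := hX1.inter hX2
  have hPX : P ⊆ X := fun x hx => hX1X hx.1
  -- the map on P
  obtain ⟨q, hq, hqN, hqB⟩ := hN P (hX.of_isClosed_subset hPc hPX)
    ⟨S', hS', fun x hx => by have := hP x hx; have := hSX x (hPX hx); omega⟩
    (P ∩ B) Set.inter_subset_left (hPc.inter hB)
    (fun x u => if u = v then 0 else f x u / (1 - f x v))
    (by
      refine continuousOn_pi.2 fun u => ?_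
      have hfu : ∀ u, ContinuousOn (fun x => f x u) (P ∩ B) := fun u =>
        (continuousOn_pi.1 hf u).mono Set.inter_subset_right
      split_ifs
      · exact continuousOn_const
      · refine (hfu u).div (continuousOn_const.sub (hfu v)) fun x hx => ?_
        have := hlo x hx.1.1
        rw [hτB x hx.2] at this
        linarith)
    (by
      intro x hx
      have h1 := hlo x hx.1.1
      have h2 := hhi x hx.1.2
      rw [hτB x hx.2] at h1 h2
      obtain ⟨f0, f1, f2, f3⟩ := hfW x hx.2
      have hpos : 0 < 1 - f x v := by linarith
      refine ⟨fun u => ?_, ?_, fun u hu => ?_, fun p q hp hq => ?_⟩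
      · dsimp only
        split_ifs
        · exact le_rfl
        · exact div_nonneg (f0 u) hpos.le
      · rw [sum_split, ← Finset.sum_div, zero_add]
        rw [← Finset.add_sum_erase _ _ (Finset.mem_univ v)] at f1
        rw [div_eq_one_iff_eq hpos.ne']; linarith
      · dsimp only
        split_ifs with h
        · rfl
        · have : f x u = 0 := by
            by_contra h'
            refine hu ⟨?_, h, f3 v u (by linarith) h'⟩
            by_contra h''
            exact h' (f2 u h'')
          rw [this, zero_div]
      · refine f3 p q (fun h => hp ?_) (fun h => hq ?_) <;> simp [h])
  -- combined map on B ∪ P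
  let q' : (Fin N → ℝ) → (V → ℝ) := fun x u => if u = v then τ x else (1 - τ x) * q x u
  have hq'c : ContinuousOn q' P := by
    refine continuousOn_pi.2 fun u => ?_
    simp only [q']
    split_ifs
    · exact hτ.continuousOn
    · exact (continuousOn_const.sub hτ.continuousOn).mul (continuousOn_pi.1 hq u)
  have hq'B : ∀ x ∈ P, x ∈ B → q' x = f x := by
    intro x hxP hxB
    have h1 := hlo x hxP.1
    funext u
    simp only [q', hqB x ⟨hxP, hxB⟩]
    rw [hτB x hxB] at h1 ⊢
    split_ifs with h
    · rw [h]
    · have : 1 - f x v ≠ 0 := by linarith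
      field_simp
  have hstarsub : (insert v {u ∈ W | u ≠ v ∧ ¬ G.Adj v u}) ⊆ W := by
    rintro u (rfl | hu)
    · exact hv
    · exact hu.1
  have hq'W : ∀ x ∈ P, q' x ∈ Rl G (insert v {u ∈ W | u ≠ v ∧ ¬ G.Adj v u}) := by
    intro x hx
    have h1 := hlo x hx.1
    have h2 := hhi x hx.2
    obtain ⟨g0, g1, g2, g3⟩ := hqN x hx
    have gv : q x v = 0 := g2 v (fun h => h.2.1 rfl)
    refine ⟨fun u => ?_, ?_, fun u hu => ?_, fun a b ha hb => ?_⟩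
    · simp only [q']
      split_ifs
      · linarith
      · exact mul_nonneg (by linarith) (g0 u)
    · simp only [q']
      rw [sum_split, ← Finset.mul_sum]
      rw [← Finset.add_sum_erase _ _ (Finset.mem_univ v), gv, zero_add] at g1
      rw [g1]; ring
    · have h : u ≠ v := fun h => hu (Or.inl h)
      simp only [q', h, if_false]
      rw [g2 u (fun h => hu (Or.inr h)), mul_zero]
    · have hmem : ∀ u, q x u ≠ 0 → ¬ G.Adj v u := by
        intro u hu
        by_contra h
        exact hu (g2 u fun h' => h'.2.2 h)
      simp only [q'] at ha hb
      by_cases hav : a = v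
      · by_cases hbv : b = v
        · rw [hav, hbv]; exact G.loopless.irrefl v
        · simp only [hbv, if_false] at hb
          rw [hav]
          exact hmem b (right_ne_zero_of_mul hb)
      · simp only [hav, if_false] at ha
        by_cases hbv : b = v
        · rw [hbv]
          exact fun h => hmem a (right_ne_zero_of_mul ha) h.symm
        · simp only [hbv, if_false] at hb
          exact g3 a b (right_ne_zero_of_mul ha) (right_ne_zero_of_mul hb)
  let k : (Fin N → ℝ) → (V → ℝ) := fun x => if x ∈ B then f x else q' x
  have hkB : ∀ x ∈ B, k x = f x := fun x hx => by simp [k, hx]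
  have hkP : ∀ x ∈ P, k x = q' x := fun x hx => by
    by_cases h : x ∈ B
    · rw [hkB x h, hq'B x hx h]
    · simp [k, h]
  have hkc : ContinuousOn k (B ∪ P) :=
    ContinuousOn.union_of_isClosed (hf.congr hkB) (hq'c.congr hkP) hB hPc
  have hkv : ∀ x ∈ B ∪ P, k x v = τ x := by
    rintro x (hx | hx)
    · rw [hkB x hx, hτB x hx]
    · rw [hkP x hx]; simp [q']
  have hkW : ∀ x ∈ B ∪ P, k x ∈ Rl G W := by
    rintro x (hx | hx)
    · rw [hkB x hx]; exact hfW x hx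
    · rw [hkP x hx]; exact Rl_mono G hstarsub (hq'W x hx)
  have hBP : IsClosed (B ∪ P) := hB.union hPc
  -- side 2
  obtain ⟨g2, hg2c, hg2W, hg2B⟩ := cone_ext G (insert v {u ∈ W | u ≠ v ∧ ¬ G.Adj v u}) v
    (Set.mem_insert _ _)
    (by
      rintro u (rfl | hu)
      · exact G.loopless.irrefl u
      · exact hu.2.2)
    ((B ∪ P) ∩ X2) (hBP.inter hX2) k (hkc.mono Set.inter_subset_left)
    (by
      rintro x ⟨hx, hx2⟩
      obtain ⟨a0, a1, a2, a3⟩ := hkW x hx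
      have hpos : k x v ≠ 0 := by
        have := hhi x hx2
        rw [hkv x hx]; linarith
      refine ⟨a0, a1, fun u hu => ?_, a3⟩
      by_contra h
      apply hu
      by_cases huv : u = v
      · exact Or.inl huv
      · refine Or.inr ⟨?_, huv, a3 v u hpos h⟩
        by_contra h'
        exact h (a2 u h'))
  obtain ⟨g1, hg1c, hg1W, hg1B⟩ := side_ext G W v hv hL X1 (hX.of_isClosed_subset hX1 hX1X)
    ⟨S, hS, fun x hx => hSX x (hX1X hx)⟩ ((B ∪ P) ∩ X1) Set.inter_subset_right (hBP.inter hX1)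
    k (hkc.mono Set.inter_subset_left) (fun x hx => hkW x hx.1)
    (fun x hx => by rw [hkv x hx.1]; exact hlo x hx.2)
  let g : (Fin N → ℝ) → (V → ℝ) := fun x => if x ∈ X1 then g1 x else g2 x
  have hgX1 : ∀ x ∈ X1, g x = g1 x := fun x hx => by simp [g, hx]
  have hgX2 : ∀ x ∈ X2, g x = g2 x := fun x hx => by
    by_cases h : x ∈ X1
    · have hxP : x ∈ P := ⟨h, hx⟩
      rw [hgX1 x h, hg1B x ⟨Or.inr hxP, h⟩, hg2B x ⟨Or.inr hxP, hx⟩]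
    · simp [g, h]
  refine ⟨g, ?_, ?_, ?_⟩
  · rw [← hXU]
    exact ContinuousOn.union_of_isClosed (hg1c.congr hgX1) (hg2c.continuousOn.congr hgX2) hX1 hX2
  · rw [← hXU]
    rintro x (hx | hx)
    · rw [hgX1 x hx]; exact hg1W x hx
    · rw [hgX2 x hx]; exact Rl_mono G hstarsub (hg2W x)
  · intro x hx
    have : x ∈ X1 ∪ X2 := hXU ▸ hBX hx
    rcases this with h | h
    · rw [hgX1 x h, hg1B x ⟨Or.inl hx, h⟩, hkB x hx]
    · rw [hgX2 x h, hg2B x ⟨Or.inl hx, h⟩, hkB x hx]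

theorem ext_cone {V : Type*} [Fintype V] (G : SimpleGraph V) {N ν : ℕ} (W : Set V) (v : V)
    (hv : v ∈ W) (hiso : ∀ u ∈ W, ¬ G.Adj v u) : RookExt G N W ν := by
  intro X _ _ B _ hB f hf hfW
  obtain ⟨g, h1, h2, h3⟩ := cone_ext G W v hv hiso B hB f hf hfW
  exact ⟨g, h1.continuousOn, fun x _ => h2 x, h3⟩

theorem ext_zero {V : Type*} [Fintype V] (G : SimpleGraph V) {N : ℕ} (W : Set V) :
    RookExt G N W 0 := by
  rintro X _ ⟨S, _, hS⟩ B hBX _ f _ _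
  have : X = ∅ := by
    ext x
    simp only [Set.mem_empty_iff_false, iff_false]
    intro hx
    have := hS x hx
    have := cnt_le S x
    omega
  subst this
  exact ⟨f, by simp, by simp, by simp⟩

/-- One step of the chessboard induction. -/
theorem chess_step {V α β : Type*} [Fintype V] [DecidableEq α] [DecidableEq β]
    (G : SimpleGraph V) (N ν : ℕ) (r : V → α) (c : V → β)
    (hsurj : ∀ a b, ∃ v, r v = a ∧ c v = b) (hinj : ∀ p q, r p = r q → c p = c q → p = q)
    (hG : ∀ p q, G.Adj p q ↔ p ≠ q ∧ (r p = r q ∨ c p = c q))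
    (IH : ∀ (A : Finset α) (B : Finset β), ν ≤ A.card → ν ≤ B.card →
      3 * ν ≤ A.card + B.card + 1 → RookExt G N {v | r v ∈ A ∧ c v ∈ B} ν)
    (A : Finset α) (B : Finset β) (hA : ν + 1 ≤ A.card) (hB : ν + 1 ≤ B.card)
    (hB2 : ν = 0 ∨ ν + 2 ≤ B.card)
    (hAB : 3 * (ν + 1) ≤ A.card + B.card + 1) :
    RookExt G N {v | r v ∈ A ∧ c v ∈ B} (ν + 1) := by
  classical
  obtain ⟨a0, ha0⟩ : A.Nonempty := Finset.card_pos.1 (by omega)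
  obtain ⟨b0, hb0⟩ : B.Nonempty := Finset.card_pos.1 (by omega)
  have claim0 : ∀ U : Finset β, U ⊆ B.erase b0 →
      RookExt G N {v | (r v ∈ A ∧ c v ∈ B.erase b0 ∧ (r v = a0 → c v ∈ U)) ∨ (r v = a0 ∧ c v = b0)}
        (ν + 1) := by
    intro U
    induction U using Finset.induction_on with
    | empty =>
      intro _
      obtain ⟨v, hv1, hv2⟩ := hsurj a0 b0
      refine ext_cone G _ v (Or.inr ⟨hv1, hv2⟩) ?_
      rintro u (⟨h1, h2, h3⟩ | ⟨h1, h2⟩) h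
      · rw [hG] at h
        rcases h.2 with h4 | h4
        · exact absurd (h3 (h4.symm.trans hv1)) (Finset.notMem_empty _)
        · exact (Finset.mem_erase.1 h2).1 (h4.symm.trans hv2)
      · rw [hG] at h
        exact h.1 (hinj _ _ (hv1.trans h1.symm) (hv2.trans h2.symm))
    | insert b U hb ih =>
      intro hU
      have hbB := hU (Finset.mem_insert_self b U)
      obtain ⟨v, hv1, hv2⟩ := hsurj a0 b
      refine glue G _ v (Or.inl ⟨hv1 ▸ ha0, hv2 ▸ hbB, fun _ => hv2 ▸ Finset.mem_insert_self _ _⟩)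
        ?_ ?_
      · convert ih ((Finset.subset_insert _ _).trans hU) using 1
        ext u
        have hu : u = v ↔ r u = a0 ∧ c u = b :=
          ⟨fun h => by rw [h]; exact ⟨hv1, hv2⟩,
            fun h => hinj _ _ (h.1.trans hv1.symm) (h.2.trans hv2.symm)⟩
        simp only [Set.mem_sdiff, Set.mem_ofPred_eq, Set.mem_singleton_iff, hu, Finset.mem_insert]
        grind
      · have hc1 : (A.erase a0).card + 1 = A.card := Finset.card_erase_add_one ha0
        have hc2 : (B.erase b0).card + 1 = B.card := Finset.card_erase_add_one hb0
        have hc3 : ((B.erase b0).erase b).card + 1 = (B.erase b0).card :=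
          Finset.card_erase_add_one hbB
        convert IH (A.erase a0) ((B.erase b0).erase b) (by omega) (by omega) (by omega) using 1
        ext u
        have hu : u = v ↔ r u = a0 ∧ c u = b :=
          ⟨fun h => by rw [h]; exact ⟨hv1, hv2⟩,
            fun h => hinj _ _ (h.1.trans hv1.symm) (h.2.trans hv2.symm)⟩
        simp only [Set.mem_ofPred_eq, hG, ne_eq, eq_comm (a := v), hu, hv1, hv2, Finset.mem_insert,
          Finset.mem_erase]
        grind
  have claim1 : ∀ T : Finset α, T ⊆ A.erase a0 →
      RookExt G N {v | (r v ∈ A ∧ c v ∈ B.erase b0) ∨ ((r v = a0 ∨ r v ∈ T) ∧ c v = b0)}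
        (ν + 1) := by
    intro T
    induction T using Finset.induction_on with
    | empty =>
      intro _
      convert claim0 (B.erase b0) subset_rfl using 1
      ext u
      simp only [Set.mem_ofPred_eq]
      grind
    | insert a T ha ih =>
      intro hT
      have haA := hT (Finset.mem_insert_self a T)
      obtain ⟨v, hv1, hv2⟩ := hsurj a b0
      refine glue G _ v (Or.inr ⟨Or.inr (hv1 ▸ Finset.mem_insert_self _ _), hv2⟩) ?_ ?_
      · convert ih ((Finset.subset_insert _ _).trans hT) using 1
        ext u
        have hu : u = v ↔ r u = a ∧ c u = b0 :=
          ⟨fun h => by rw [h]; exact ⟨hv1, hv2⟩,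
            fun h => hinj _ _ (h.1.trans hv1.symm) (h.2.trans hv2.symm)⟩
        simp only [Set.mem_sdiff, Set.mem_ofPred_eq, Set.mem_singleton_iff, hu, Finset.mem_insert]
        grind
      · have haA' := Finset.mem_of_mem_erase haA
        have hc1 : (A.erase a).card + 1 = A.card := Finset.card_erase_add_one haA'
        have hc2 : (B.erase b0).card + 1 = B.card := Finset.card_erase_add_one hb0
        convert IH (A.erase a) (B.erase b0) (by omega) (by omega) (by omega) using 1
        ext u
        have hu : u = v ↔ r u = a ∧ c u = b0 :=
          ⟨fun h => by rw [h]; exact ⟨hv1, hv2⟩,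
            fun h => hinj _ _ (h.1.trans hv1.symm) (h.2.trans hv2.symm)⟩
        simp only [Set.mem_ofPred_eq, hG, ne_eq, eq_comm (a := v), hu, hv1, hv2, Finset.mem_insert,
          Finset.mem_erase]
        grind
  convert claim1 (A.erase a0) subset_rfl using 1
  ext u
  simp only [Set.mem_ofPred_eq, Finset.mem_erase]
  grind

theorem chess_ext {V α β : Type*} [Fintype V] [DecidableEq α] [DecidableEq β]
    (G : SimpleGraph V) (N : ℕ) (r : V → α) (c : V → β)
    (hsurj : ∀ a b, ∃ v, r v = a ∧ c v = b) (hinj : ∀ p q, r p = r q → c p = c q → p = q)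
    (hG : ∀ p q, G.Adj p q ↔ p ≠ q ∧ (r p = r q ∨ c p = c q)) (ν : ℕ) :
    ∀ (A : Finset α) (B : Finset β), ν ≤ A.card → ν ≤ B.card →
      3 * ν ≤ A.card + B.card + 1 → RookExt G N {v | r v ∈ A ∧ c v ∈ B} ν := by
  induction ν with
  | zero => intro A B _ _ _; exact ext_zero G _
  | succ ν IH =>
    intro A B hA hB hAB
    by_cases h : ν = 0 ∨ ν + 2 ≤ B.card
    · exact chess_step G N ν r c hsurj hinj hG IH A B hA hB h hAB
    · have := chess_step G N ν c r (fun a b => (hsurj b a).imp fun _ h => h.symm)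
        (fun p q h1 h2 => hinj p q h2 h1) (fun p q => by rw [hG, or_comm])
        (fun A B h1 h2 h3 => by
          simpa only [and_comm] using IH B A h2 h1 (by omega)) B A hB hA (by omega) (by omega)
      simpa only [and_comm] using this

/-- the rook attack graph -/
def rookGraph (m n : ℕ) : SimpleGraph (Fin n × Fin m) where
  Adj p q := p ≠ q ∧ (p.1 = q.1 ∨ p.2 = q.2)
  symm := ⟨fun _ _ h => ⟨h.1.symm, h.2.imp Eq.symm Eq.symm⟩⟩
  loopless := ⟨fun _ h => h.1 rfl⟩

theorem Rl_rook (m n : ℕ) : Rl (rookGraph m n)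
    {v | v.1 ∈ (Finset.univ : Finset (Fin n)) ∧ v.2 ∈ (Finset.univ : Finset (Fin m))} =
    ChessRealization m n := by
  ext w
  simp only [Rl, ChessRealization, rookGraph, Set.mem_ofPred_eq, Finset.mem_univ, and_self,
    not_true_eq_false, false_imp_iff, implies_true, true_and]
  grind

/-- The chessboard complex Δ_{m,n} is (ν − 2)-connected,
where ν = min {m, n, ⌊(m + n + 1)/3⌋}. -/
theorem chessboard_connectivity (m n : ℕ) :
    IsKConnected (ChessRealization m n)
      ((min m (min n ((m + n + 1) / 3)) : ℤ) - 2) := by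
  classical
  refine ⟨fun h => ?_, fun l hl f => ?_⟩
  · have hm : 0 < m := by omega
    have hn : 0 < n := by omega
    let v : Fin n × Fin m := (⟨0, hn⟩, ⟨0, hm⟩)
    refine ⟨⟨Pi.single v 1, fun u => ?_, by simp, fun p q hp hq hpq => ?_⟩⟩
    · by_cases h : u = v
      · subst h; simp
      · simp [h]
    · have h1 : p = v := by by_contra h; exact hp (by simp [h])
      have h2 : q = v := by by_contra h; exact hq (by simp [h])
      exact absurd (h1.trans h2.symm) hpq
  · have hext := chess_ext (rookGraph m n) (l + 1) Prod.fst Prod.snd (fun a b => ⟨(a, b), rfl, rfl⟩)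
      (fun p q h1 h2 => Prod.ext h1 h2) (fun p q => Iff.rfl) (l + 2) Finset.univ Finset.univ
      (by simp; omega) (by simp; omega) (by simp; omega)
    let e := EuclideanSpace.equiv (Fin (l + 1)) ℝ
    let f' : (Fin (l + 1) → ℝ) → (Fin n × Fin m → ℝ) := fun x =>
      if h : e.symm x ∈ sphere (0 : EuclideanSpace ℝ (Fin (l + 1))) 1 then (f ⟨_, h⟩).1 else 0
    have hf' : ∀ (x) (h : e.symm x ∈ sphere (0 : EuclideanSpace ℝ (Fin (l + 1))) 1),
        f' x = (f ⟨_, h⟩).1 := fun x h => dif_pos h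
    let X : Set (Fin (l + 1) → ℝ) := e.symm ⁻¹' closedBall 0 1
    let B : Set (Fin (l + 1) → ℝ) := e.symm ⁻¹' sphere 0 1
    have hX : IsCompact X :=
      e.symm.toHomeomorph.isCompact_preimage.2 (isCompact_closedBall _ _)
    have hB : IsClosed B := isClosed_sphere.preimage e.symm.continuous
    obtain ⟨g, hg, hgW, hgB⟩ := hext X hX ⟨∅, Set.countable_empty, fun x _ => by omega⟩ B
      (Set.preimage_mono sphere_subset_closedBall) hB f'
      (by
        rw [continuousOn_iff_continuous_domRestrict]
        have : B.domRestrict f' = fun x : B => (f ⟨e.symm x.1, x.2⟩).1 := by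
          funext x; exact hf' x.1 x.2
        rw [this]
        refine continuous_subtype_val.comp (f.continuous.comp ?_)
        exact Continuous.subtype_mk (e.symm.continuous.comp continuous_subtype_val) _)
      (by
        intro x hx
        rw [hf' x hx, Rl_rook]
        exact (f _).2)
    rw [Rl_rook] at hgW
    have hmem : ∀ x : closedBall (0 : EuclideanSpace ℝ (Fin (l + 1))) 1, e x.1 ∈ X := fun x => by
      simp only [X, Set.mem_preimage, e.symm_apply_apply]; exact x.2
    refine ⟨⟨fun x => ⟨g (e x.1), hgW _ (hmem x)⟩, ?_⟩, ?_⟩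
    · refine Continuous.subtype_mk ?_ _
      exact hg.comp_continuous (e.continuous.comp continuous_subtype_val) hmem
    · intro x
      have hx : e x.1 ∈ B := by
        simp only [B, Set.mem_preimage, e.symm_apply_apply]; exact x.2
      apply Subtype.ext
      simp only [ContinuousMap.coe_mk]
      rw [hgB _ hx, hf' _ hx]
      congr 2
end

section
/- Let d ≥ 1, k ≥ 2, and let X be a set of k(d+1) points in ℝ^d in general position with respect to the origin. Then the number B₀(X) of Birch partitions of X for the origin is even. -/
/-- A Birch partition of a finite point set `X ⊆ ℝ^d` for the origin:
a partition of `X` into `k` subsets of size `d + 1`, each containing the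
origin in its convex hull. -/
def IsBirchPartition (d k : ℕ) (X : Finset (EuclideanSpace ℝ (Fin d)))
    (P : Finset (Finset (EuclideanSpace ℝ (Fin d)))) : Prop :=
  P.card = k ∧
  (∀ S ∈ P, S ⊆ X ∧ S.card = d + 1 ∧
    (0 : EuclideanSpace ℝ (Fin d)) ∈ convexHull ℝ (S : Set (EuclideanSpace ℝ (Fin d)))) ∧
  (∀ x ∈ X, ∃! S, S ∈ P ∧ x ∈ S)

/-- Abstract partitions of `X` into `k` blocks of size `n` satisfying `F`. -/
def BPart {α : Type*} (n : ℕ) (F : Finset α → Prop) (k : ℕ) (X : Finset α)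
    (P : Finset (Finset α)) : Prop :=
  P.card = k ∧ (∀ S ∈ P, S ⊆ X ∧ S.card = n ∧ F S) ∧ (∀ x ∈ X, ∃! S, S ∈ P ∧ x ∈ S)

open Classical in
/-- The finset of abstract partitions. -/
noncomputable def BV {α : Type*} (n : ℕ) (F : Finset α → Prop) (k : ℕ) (X : Finset α) :
    Finset (Finset (Finset α)) :=
  X.powerset.powerset.filter (BPart n F k X)

theorem mem_BV {α : Type*} (n : ℕ) (F : Finset α → Prop) (k : ℕ) (X : Finset α)
    (P : Finset (Finset α)) : P ∈ BV n F k X ↔ BPart n F k X P := by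
  unfold BV
  simp only [Finset.mem_filter, Finset.mem_powerset, and_iff_right_iff_imp]
  intro h S hS
  exact Finset.mem_powerset.2 (h.2.1 S hS).1

open Classical in
theorem BV_fiber {α : Type*} (n : ℕ) (F : Finset α → Prop) (k : ℕ) (X S : Finset α)
    (x0 : α) (hx : x0 ∈ S) (hS : S ⊆ X) (hn : S.card = n) (hF : F S) :
    ((BV n F (k+1) X).filter (fun P => S ∈ P)).card = (BV n F k (X \ S)).card := by
  refine Finset.card_nbij' (fun P => P.erase S) (fun P => insert S P) ?_ ?_ ?_ ?_
  · intro P hP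
    simp only [Finset.coe_filter, mem_BV, Set.mem_ofPred_eq] at hP
    obtain ⟨⟨h1, h2, h3⟩, h4⟩ := hP
    simp only [Finset.mem_coe, mem_BV]
    refine ⟨by rw [Finset.card_erase_of_mem h4]; omega, ?_, ?_⟩
    · intro U hU
      obtain ⟨hne, hU⟩ := Finset.mem_erase.1 hU
      refine ⟨?_, (h2 U hU).2⟩
      intro y hy
      refine Finset.mem_sdiff.2 ⟨(h2 U hU).1 hy, fun hyS => hne ?_⟩
      exact (h3 y (hS hyS)).unique ⟨hU, hy⟩ ⟨h4, hyS⟩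
    · intro x hx
      obtain ⟨hxX, hxS⟩ := Finset.mem_sdiff.1 hx
      obtain ⟨U, ⟨hU, hxU⟩, hu⟩ := h3 x hxX
      refine ⟨U, ⟨Finset.mem_erase.2 ⟨?_, hU⟩, hxU⟩, ?_⟩
      · rintro rfl; exact hxS hxU
      · rintro W ⟨hW, hxW⟩
        exact hu W ⟨(Finset.mem_erase.1 hW).2, hxW⟩
  · intro P hP
    simp only [Finset.mem_coe, mem_BV] at hP
    obtain ⟨h1, h2, h3⟩ := hP
    have hSP : S ∉ P := fun h => (Finset.mem_sdiff.1 ((h2 S h).1 hx)).2 hx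
    simp only [Finset.coe_filter, mem_BV, Set.mem_ofPred_eq, Finset.mem_insert_self, and_true]
    refine ⟨by rw [Finset.card_insert_of_notMem hSP, h1], ?_, ?_⟩
    · intro U hU
      rcases Finset.mem_insert.1 hU with rfl | hU
      · exact ⟨hS, hn, hF⟩
      · exact ⟨(h2 U hU).1.trans Finset.sdiff_subset, (h2 U hU).2⟩
    · intro x hxX
      by_cases hxS : x ∈ S
      · refine ⟨S, ⟨Finset.mem_insert_self _ _, hxS⟩, ?_⟩
        rintro W ⟨hW, hxW⟩
        rcases Finset.mem_insert.1 hW with rfl | hW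
        · rfl
        · exact absurd hxS (Finset.mem_sdiff.1 ((h2 W hW).1 hxW)).2
      · obtain ⟨U, ⟨hU, hxU⟩, hu⟩ := h3 x (Finset.mem_sdiff.2 ⟨hxX, hxS⟩)
        refine ⟨U, ⟨Finset.mem_insert_of_mem hU, hxU⟩, ?_⟩
        rintro W ⟨hW, hxW⟩
        rcases Finset.mem_insert.1 hW with rfl | hW
        · exact absurd hxW hxS
        · exact hu W ⟨hW, hxW⟩
  · intro P hP
    simp only [Finset.coe_filter, Set.mem_ofPred_eq] at hP
    exact Finset.insert_erase hP.2
  · intro P hP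
    simp only [Finset.mem_coe, mem_BV] at hP
    obtain ⟨h1, h2, h3⟩ := hP
    have hSP : S ∉ P := fun h => (Finset.mem_sdiff.1 ((h2 S h).1 hx)).2 hx
    exact Finset.erase_insert hSP

open Classical in
theorem BV_rec {α : Type*} (n : ℕ) (F : Finset α → Prop) (k : ℕ) (X : Finset α)
    (x0 : α) (hx : x0 ∈ X) :
    (BV n F (k+1) X).card = ∑ S ∈ (X.powerset.filter (fun S => x0 ∈ S ∧ S.card = n ∧ F S)),
      (BV n F k (X \ S)).card := by
  have h : ∀ S ∈ (X.powerset.filter (fun S => x0 ∈ S ∧ S.card = n ∧ F S)),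
      (BV n F k (X \ S)).card = ((BV n F (k+1) X).filter (fun P => S ∈ P)).card := by
    intro S hS
    simp only [Finset.mem_filter, Finset.mem_powerset] at hS
    exact (BV_fiber n F k X S x0 hS.2.1 hS.1 hS.2.2.1 hS.2.2.2).symm
  rw [Finset.sum_congr rfl h, ← Finset.card_biUnion]
  · congr 1
    ext P
    simp only [Finset.mem_biUnion, Finset.mem_filter, Finset.mem_powerset, mem_BV]
    constructor
    · intro hP
      obtain ⟨S, ⟨hS, hxS⟩, -⟩ := hP.2.2 x0 hx
      have := hP.2.1 S hS
      exact ⟨S, ⟨this.1, hxS, this.2⟩, hP, hS⟩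
    · rintro ⟨S, -, hP, -⟩
      exact hP
  · intro S hS U hU hne
    simp only [Finset.coe_filter, Set.mem_ofPred_eq] at hS hU
    refine Finset.disjoint_left.2 fun P hP hP' => hne ?_
    simp only [Finset.mem_filter, mem_BV] at hP hP'
    exact (hP.1.2.2 x0 hx).unique ⟨hP.2, hS.2.1⟩ ⟨hP'.2, hU.2.1⟩

open Classical in
theorem BV_one {α : Type*} (n : ℕ) (F : Finset α → Prop) (X : Finset α) (hX : X.card = n)
    (h0 : X.Nonempty) :
    (BV n F 1 X).card = if F X then 1 else 0 := by
  have key : ∀ P, BPart n F 1 X P ↔ (P = {X} ∧ F X) := by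
    intro P
    constructor
    · rintro ⟨h1, h2, h3⟩
      obtain ⟨S, rfl⟩ := Finset.card_eq_one.1 h1
      obtain ⟨a, b, c⟩ := h2 S (Finset.mem_singleton_self _)
      have : S = X := Finset.eq_of_subset_of_card_le a (by omega)
      subst this
      exact ⟨rfl, c⟩
    · rintro ⟨rfl, h⟩
      refine ⟨by simp, ?_, ?_⟩
      · intro S hS
        rw [Finset.mem_singleton.1 hS]
        exact ⟨Finset.Subset.refl _, hX, h⟩
      · intro x hx
        exact ⟨X, ⟨by simp, hx⟩, fun W hW => by simpa using hW.1⟩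
  split_ifs with h
  · rw [Finset.card_eq_one]
    refine ⟨{X}, ?_⟩
    ext P
    rw [mem_BV, key]; simp [h]
  · rw [Finset.card_eq_zero]
    ext P
    rw [mem_BV, key]; simp [h]

open Classical in
/-- The parity computation for two blocks. -/
theorem two_block_sum {α : Type*} (d : ℕ) (hd : 1 ≤ d) (g : Finset α → ZMod 2) (X : Finset α) (x0 : α)
    (hx0 : x0 ∈ X) (hX : X.card = 2 * (d + 1)) :
    ∑ S ∈ X.powerset.filter (fun S => x0 ∈ S ∧ S.card = d + 1),
      (∑ x ∈ S, g (S.erase x)) * (∑ y ∈ X \ S, g ((X \ S).erase y)) = 0 := by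
  have h2 : ∀ a : ZMod 2, a + a = 0 := by decide
  simp only [Finset.sum_mul_sum]
  simp only [← Finset.sum_product']
  rw [Finset.sum_sigma']
  refine Finset.sum_involution (fun t _ =>
    if t.2.1 = x0 then ⟨insert x0 ((X \ t.1).erase t.2.2), (x0, t.2.2)⟩
    else ⟨insert t.2.2 (t.1.erase t.2.1), (t.2.2, t.2.1)⟩) ?_ ?_ ?_ ?_
  · rintro ⟨S, x, y⟩ ht
    simp only [Finset.mem_sigma, Finset.mem_filter, Finset.mem_powerset, Finset.mem_product,
      Finset.mem_sdiff] at ht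
    obtain ⟨⟨hS, hxS, hc⟩, hx, hyX, hyS⟩ := ht
    by_cases h : x = x0
    · subst h
      simp only [if_true]
      have e1 : (insert x ((X \ S).erase y)).erase x = (X \ S).erase y :=
        Finset.erase_insert (by grind)
      have e2 : (X \ insert x ((X \ S).erase y)).erase y = S.erase x := by
        ext z; simp only [Finset.mem_erase, Finset.mem_sdiff, Finset.mem_insert]
        have := @hS z
        grind
      rw [e1, e2, mul_comm (g ((X \ S).erase y))]
      exact h2 _
    · simp only [h, if_false]
      have e1 : (insert y (S.erase x)).erase y = S.erase x :=
        Finset.erase_insert (by grind)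
      have e2 : (X \ insert y (S.erase x)).erase x = (X \ S).erase y := by
        ext z; simp only [Finset.mem_erase, Finset.mem_sdiff, Finset.mem_insert]
        have := @hS z
        grind
      rw [e1, e2]
      exact h2 _
  · rintro ⟨S, x, y⟩ ht _ heq
    simp only [Finset.mem_sigma, Finset.mem_filter, Finset.mem_powerset, Finset.mem_product,
      Finset.mem_sdiff] at ht
    obtain ⟨⟨hS, hxS, hc⟩, hx, hyX, hyS⟩ := ht
    by_cases h : x = x0
    · subst h
      simp only [if_true, Sigma.mk.injEq, heq_eq_eq] at heq
      have e3 : X = insert y S := by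
        ext z
        have := @hS z
        have h5 : z ∈ insert x ((X \ S).erase y) ↔ z ∈ S := by rw [heq.1]
        simp only [Finset.mem_erase, Finset.mem_sdiff, Finset.mem_insert] at h5 ⊢
        grind
      have e4 : S = {x} := by
        ext z
        have := @hS z
        have h5 : z ∈ insert x ((X \ S).erase y) ↔ z ∈ S := by rw [heq.1]
        simp only [Finset.mem_erase, Finset.mem_sdiff, Finset.mem_insert] at h5 
        simp only [Finset.mem_singleton]
        grind
      rw [e4, Finset.card_singleton] at hc
      omega
    · simp only [h, if_false, Sigma.mk.injEq, heq_eq_eq, Prod.mk.injEq] at heq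
      grind
  · rintro ⟨S, x, y⟩ ht
    simp only [Finset.mem_sigma, Finset.mem_filter, Finset.mem_powerset, Finset.mem_product,
      Finset.mem_sdiff] at ht
    obtain ⟨⟨hS, hxS, hc⟩, hx, hyX, hyS⟩ := ht
    have hc' : (X \ S).card = d + 1 := by rw [Finset.card_sdiff_of_subset hS]; omega
    by_cases h : x = x0
    · subst h
      simp only [if_true, Finset.mem_sigma, Finset.mem_filter, Finset.mem_powerset,
        Finset.mem_product, Finset.mem_sdiff]
      have : (insert x ((X \ S).erase y)).card = d + 1 := by
        rw [Finset.card_insert_of_notMem (by grind), Finset.card_erase_of_mem (by grind)]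
        omega
      grind
    · simp only [h, if_false, Finset.mem_sigma, Finset.mem_filter, Finset.mem_powerset,
        Finset.mem_product, Finset.mem_sdiff]
      have : (insert y (S.erase x)).card = d + 1 := by
        rw [Finset.card_insert_of_notMem (by grind), Finset.card_erase_of_mem (by grind)]
        omega
      grind
  · rintro ⟨S, x, y⟩ ht
    simp only [Finset.mem_sigma, Finset.mem_filter, Finset.mem_powerset, Finset.mem_product,
      Finset.mem_sdiff] at ht
    obtain ⟨⟨hS, hxS, hc⟩, hx, hyX, hyS⟩ := ht
    by_cases h : x = x0
    · subst h
      simp only [if_true, Sigma.mk.injEq, heq_eq_eq, and_true]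
      ext z
      have := @hS z
      simp only [Finset.mem_erase, Finset.mem_sdiff, Finset.mem_insert]
      grind
    · have hy : y ≠ x0 := by rintro rfl; exact hyS hxS
      simp only [h, hy, if_false, Sigma.mk.injEq, heq_eq_eq, and_true]
      ext z
      simp only [Finset.mem_erase, Finset.mem_insert]
      grind

open Classical in
theorem BV_even {α : Type*} (d : ℕ) (hd : 1 ≤ d) (F : Finset α → Prop) (g : Finset α → ZMod 2)
    (k : ℕ) : ∀ X : Finset α, X.card = (k + 2) * (d + 1) →
    (∀ S ⊆ X, S.card = d + 1 → (if F S then 1 else 0 : ZMod 2) = ∑ x ∈ S, g (S.erase x)) →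
    (((BV (d + 1) F (k + 2) X).card : ℕ) : ZMod 2) = 0 := by
  induction k with
  | zero =>
    intro X hX hg
    have hne : X.Nonempty := by
      rw [← Finset.card_pos, hX]; positivity
    obtain ⟨x0, hx0⟩ := hne
    have hX' : X.card = 2 * (d + 1) := by rw [hX]
    rw [BV_rec _ _ _ _ x0 hx0, ← two_block_sum d hd g X x0 hx0 hX', Nat.cast_sum]
    have e : X.powerset.filter (fun S => x0 ∈ S ∧ S.card = d + 1 ∧ F S) =
        (X.powerset.filter (fun S => x0 ∈ S ∧ S.card = d + 1)).filter F := by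
      ext S; simp only [Finset.mem_filter]; tauto
    rw [e, Finset.sum_filter]
    refine Finset.sum_congr rfl fun S hS => ?_
    simp only [Finset.mem_filter, Finset.mem_powerset] at hS
    have hc' : (X \ S).card = d + 1 := by rw [Finset.card_sdiff_of_subset hS.1]; omega
    rw [← hg S hS.1 hS.2.2, ← hg _ Finset.sdiff_subset hc',
      BV_one _ _ _ hc' (Finset.card_pos.1 (by omega))]
    split_ifs <;> simp
  | succ k ih =>
    intro X hX hg
    have hne : X.Nonempty := by
      rw [← Finset.card_pos, hX]; positivity
    obtain ⟨x0, hx0⟩ := hne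
    rw [BV_rec _ _ _ _ x0 hx0, Nat.cast_sum]
    refine Finset.sum_eq_zero fun S hS => ?_
    simp only [Finset.mem_filter, Finset.mem_powerset] at hS
    refine ih _ ?_ fun U hU => hg U (hU.trans Finset.sdiff_subset)
    rw [Finset.card_sdiff_of_subset hS.1, hX, hS.2.2.1]
    have : (k + 1 + 2) * (d + 1) = (k + 2) * (d + 1) + (d + 1) := by ring
    omega

/-- Pivoting in a two-dimensional space of dependencies. -/
theorem pivot_even {E : Type*} [DecidableEq E] (T : Finset E) (K : Submodule ℝ (E → ℝ))
    (hT : 3 ≤ T.card)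
    (h2 : ∀ w ∈ K, ∀ a ∈ T, ∀ b ∈ T, a ≠ b → w a = 0 → w b = 0 → ∀ x ∈ T, w x = 0)
    (h1 : ∀ a ∈ T, ∃ w ∈ K, w a = 1)
    (A : Finset E) (hA : ∀ a, a ∈ A ↔ a ∈ T ∧ ∃ w ∈ K, (∀ x ∈ T, 0 ≤ w x) ∧ w a = 0 ∧
      ∃ x ∈ T, 0 < w x) : Even A.card := by
  have hpos : ∀ a ∈ A, ∃ w ∈ K, w a = 0 ∧ ∀ x ∈ T, x ≠ a → 0 < w x := by
    intro a ha
    obtain ⟨haT, w, hw, hw0, hwa, x, hx, hwx⟩ := (hA a).1 ha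
    refine ⟨w, hw, hwa, fun y hy hya => lt_of_le_of_ne (hw0 y hy) fun h => ?_⟩
    have := h2 w hw a haT y hy hya.symm hwa h.symm x hx
    linarith
  have hATs : ∀ a ∈ A, a ∈ T := fun a ha => ((hA a).1 ha).1
  rcases A.eq_empty_or_nonempty with rfl | ⟨a, ha⟩
  · simp
  obtain ⟨l, hl, hla, hlpos⟩ := hpos a ha
  have haT := hATs a ha
  suffices h : (A.erase a).card = 1 by
    rw [Finset.card_erase_of_mem ha] at h
    have : A.card = 2 := by omega
    rw [this]; exact even_two
  obtain ⟨m, hm, hma⟩ := h1 a haT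
  have hne : (T.erase a).Nonempty := by
    rw [← Finset.card_pos, Finset.card_erase_of_mem haT]; omega
  obtain ⟨b, hb, hmax⟩ := Finset.exists_max_image (T.erase a) (fun i => - m i / l i) hne
  obtain ⟨hba, hbT⟩ := Finset.mem_erase.1 hb
  have hlb := hlpos b hbT hba
  rw [Finset.card_eq_one]
  have hbA : b ∈ A := by
    rw [hA]
    refine ⟨hbT, m + (- m b / l b) • l, K.add_mem hm (K.smul_mem _ hl), ?_, ?_, a, haT, ?_⟩
    · intro x hx
      simp only [Pi.add_apply, Pi.smul_apply, smul_eq_mul]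
      by_cases hxa : x = a
      · subst hxa; rw [hla, hma]; norm_num
      · have hlx := hlpos x hx hxa
        have := hmax x (Finset.mem_erase.2 ⟨hxa, hx⟩)
        rw [div_le_iff₀ hlx] at this
        linarith
    · simp only [Pi.add_apply, Pi.smul_apply, smul_eq_mul]
      field_simp; ring
    · simp only [Pi.add_apply, Pi.smul_apply, smul_eq_mul]
      rw [hla, hma]; norm_num
  refine ⟨b, ?_⟩
  ext c
  rw [Finset.mem_singleton, Finset.mem_erase]
  constructor
  swap
  · rintro rfl; exact ⟨hba, hbA⟩
  rintro ⟨hca, hcA⟩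
  by_contra hcb
  have hcT := hATs c hcA
  obtain ⟨u, hu, hub, hup⟩ := hpos b hbA
  obtain ⟨v, hv, hvc, hvp⟩ := hpos c hcA
  have hua := hup a haT hba.symm
  have hva := hvp a haT (Ne.symm hca)
  have huc := hup c hcT hcb
  have hvb := hvp b hbT (Ne.symm hcb)
  have hlc := hlpos c hcT hca
  -- D = u a • v - v a • u vanishes at a
  have hD := h2 (u a • v - v a • u - (u a * v b / l b) • l)
    (K.sub_mem (K.sub_mem (K.smul_mem _ hv) (K.smul_mem _ hu)) (K.smul_mem _ hl))
    a haT b hbT hba.symm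
    (by simp only [Pi.sub_apply, Pi.smul_apply, smul_eq_mul, hla]; ring)
    (by simp only [Pi.sub_apply, Pi.smul_apply, smul_eq_mul, hub]; field_simp; ring)
    c hcT
  simp only [Pi.sub_apply, Pi.smul_apply, smul_eq_mul, hvc] at hD
  have p1 : 0 < v a * u c := mul_pos hva huc
  have p2 : 0 < u a * v b / l b * l c := by positivity
  linarith

open Classical in
theorem hull_even {E : Type*} [AddCommGroup E] [Module ℝ E]
    [FiniteDimensional ℝ E] (d : ℕ) (hd : 1 ≤ d) (hE : Module.finrank ℝ E = d) (T : Finset (E))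
    (hT : T.card = d + 2)
    (hgp : ∀ R ⊆ T, R.card = d → ∀ w : E → ℝ,
      ∑ x ∈ R, w x • x = 0 → ∀ x ∈ R, w x = 0) :
    Even (T.filter (fun a => (0 : E) ∈
      convexHull ℝ ((T.erase a : Finset (E)) :
        Set (E)))).card := by
  let K : Submodule ℝ (E → ℝ) :=
    { carrier := {w | ∑ x ∈ T, w x • x = 0}
      add_mem' := by
        intro a b ha hb
        simp only [Set.mem_ofPred_eq] at *
        simp only [Pi.add_apply, add_smul, Finset.sum_add_distrib, ha, hb, add_zero]
      zero_mem' := by simp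
      smul_mem' := by
        intro c a ha
        simp only [Set.mem_ofPred_eq] at *
        simp only [Pi.smul_apply, smul_eq_mul, mul_smul, ← Finset.smul_sum, ha, smul_zero] }
  have hK : ∀ w, w ∈ K ↔ ∑ x ∈ T, w x • x = 0 := fun w => Iff.rfl
  have h2 : ∀ w ∈ K, ∀ a ∈ T, ∀ b ∈ T, a ≠ b → w a = 0 → w b = 0 → ∀ x ∈ T, w x = 0 := by
    intro w hw a ha b hb hab hwa hwb x hx
    by_cases hxa : x = a
    · rw [hxa, hwa]
    by_cases hxb : x = b
    · rw [hxb, hwb]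
    refine hgp ((T.erase a).erase b) ((Finset.erase_subset _ _).trans (Finset.erase_subset _ _))
      ?_ w ?_ x ?_
    · rw [Finset.card_erase_of_mem (by grind), Finset.card_erase_of_mem ha]; omega
    · rw [Finset.sum_erase _ (by rw [hwb, zero_smul]), Finset.sum_erase _ (by rw [hwa, zero_smul])]
      exact hw
    · grind
  have ext0 : ∀ a ∈ T, ∀ w : E → ℝ, ∑ x ∈ T.erase a, w x • x = 0 →
      Function.update w a 0 ∈ K := by
    intro a ha w hw
    rw [hK, ← Finset.add_sum_erase _ _ ha, ← hw]
    simp only [Function.update_self, zero_smul, zero_add]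
    refine Finset.sum_congr rfl fun x hx => ?_
    rw [Function.update_of_ne (Finset.ne_of_mem_erase hx)]
  refine pivot_even T K (by omega) h2 ?_ _ ?_
  · intro a ha
    obtain ⟨c, hc, hca⟩ : ∃ c ∈ T, c ≠ a := Finset.exists_mem_ne (by omega) a
    obtain ⟨f, hf, x, hx, hfx⟩ := Module.exists_nontrivial_relation_of_finrank_lt_card
      (R := ℝ) (t := T.erase c)
      (by rw [Finset.card_erase_of_mem hc, hE]; omega)
    have hu := ext0 c hc f hf
    have hua : Function.update f c 0 a ≠ 0 := by
      intro h0
      have := h2 _ hu c hc a ha hca (by simp) h0 x (Finset.mem_of_mem_erase hx)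
      rw [Function.update_of_ne (Finset.ne_of_mem_erase hx)] at this
      exact hfx this
    refine ⟨(Function.update f c 0 a)⁻¹ • Function.update f c 0, K.smul_mem _ hu, ?_⟩
    rw [Pi.smul_apply, smul_eq_mul, inv_mul_cancel₀ hua]
  · intro a
    rw [Finset.mem_filter, and_congr_right_iff]
    intro ha
    rw [Finset.mem_convexHull']
    constructor
    · rintro ⟨w, hw0, hw1, hw⟩
      refine ⟨_, ext0 a ha w hw, ?_, by simp, ?_⟩
      · intro x hx
        by_cases hxa : x = a
        · subst hxa; simp
        · rw [Function.update_of_ne hxa]; exact hw0 x (Finset.mem_erase.2 ⟨hxa, hx⟩)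
      · obtain ⟨x, hx, hxp⟩ := Finset.exists_lt_of_sum_lt (s := T.erase a) (f := fun _ => (0:ℝ))
          (g := w) (by rw [hw1]; simp)
        refine ⟨x, Finset.mem_of_mem_erase hx, ?_⟩
        rwa [Function.update_of_ne (Finset.ne_of_mem_erase hx)]
    · rintro ⟨w, hw, hw0, hwa, x, hx, hxp⟩
      have hs : 0 < ∑ y ∈ T, w y := Finset.sum_pos' hw0 ⟨x, hx, hxp⟩
      have hs' : ∑ y ∈ T.erase a, w y = ∑ y ∈ T, w y := Finset.sum_erase _ hwa
      have hw' : ∑ y ∈ T.erase a, w y • y = 0 := by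
        rw [Finset.sum_erase _ (by rw [hwa, zero_smul])]; exact hw
      refine ⟨fun y => (∑ y ∈ T, w y)⁻¹ * w y, ?_, ?_, ?_⟩
      · intro y hy
        have := hw0 y (Finset.mem_of_mem_erase hy)
        positivity
      · rw [← Finset.mul_sum, hs', inv_mul_cancel₀ hs.ne']
      · simp only [mul_smul, ← Finset.smul_sum, hw', smul_zero]

open Classical in
theorem exists_cochain {α : Type*} (d : ℕ) (F : Finset α → Prop) (X : Finset α) (z : α)
    (hz : z ∈ X)
    (hF : ∀ T ⊆ X, T.card = d + 2 → Even (T.filter (fun a => F (T.erase a))).card) :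
    ∃ g : Finset α → ZMod 2, ∀ S ⊆ X, S.card = d + 1 →
      (if F S then 1 else 0 : ZMod 2) = ∑ x ∈ S, g (S.erase x) := by
  refine ⟨fun R => if z ∈ R then 0 else if F (insert z R) then 1 else 0, ?_⟩
  intro S hS hc
  by_cases hzS : z ∈ S
  · rw [Finset.sum_eq_single_of_mem z hzS]
    · simp [Finset.insert_erase hzS]
    · intro b hb hbz
      beta_reduce
      rw [if_pos (Finset.mem_erase.2 ⟨hbz.symm, hzS⟩)]
  · have h := hF (insert z S) (Finset.insert_subset hz hS)
      (by rw [Finset.card_insert_of_notMem hzS, hc])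
    rw [← ZMod.natCast_eq_zero_iff_even, Finset.card_filter, Nat.cast_sum,
      Finset.sum_insert hzS, Finset.erase_insert hzS] at h
    have h2 : ∀ a b : ZMod 2, a + b = 0 → a = b := by decide
    have h' := h2 _ _ h
    push_cast at h'
    rw [h']
    refine Finset.sum_congr rfl fun x hx => ?_
    have hzx : z ∉ S.erase x := fun h => hzS (Finset.mem_of_mem_erase h)
    have hne : z ≠ x := by rintro rfl; exact hzS hx
    beta_reduce
    rw [if_neg hzx, Finset.erase_insert_of_ne hne]

theorem gen_pos (d : ℕ) (X : Finset (EuclideanSpace ℝ (Fin d)))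
    (hgen : AlgebraicIndependent ℚ
      (fun p : {x // x ∈ X} × Fin d => (p.1 : EuclideanSpace ℝ (Fin d)) p.2))
    (R : Finset (EuclideanSpace ℝ (Fin d))) (hR : R ⊆ X) (hc : R.card = d)
    (w : EuclideanSpace ℝ (Fin d) → ℝ) (hw : ∑ x ∈ R, w x • x = 0) :
    ∀ x ∈ R, w x = 0 := by
  let e : Fin d ≃ R := (R.equivFinOfCardEq hc).symm
  let φ : Fin d × Fin d → {x // x ∈ X} × Fin d := fun p => (⟨e p.1, hR (e p.1).2⟩, p.2)
  have hφ : Function.Injective φ := by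
    rintro ⟨a, b⟩ ⟨a', b'⟩ h
    simp only [φ, Prod.mk.injEq, Subtype.mk.injEq] at h
    have := e.injective (Subtype.ext h.1)
    rw [this, h.2]
  have hi := hgen.comp φ hφ
  let M : Matrix (Fin d) (Fin d) ℝ := Matrix.of fun i j => (e i : EuclideanSpace ℝ (Fin d)) j
  have hdet : M.det ≠ 0 := by
    intro h0
    apply Matrix.det_mvPolynomialX_ne_zero (Fin d) ℚ
    apply hi
    rw [map_zero, AlgHom.map_det, ← h0]
    congr 1
    ext i j
    simp [M, φ, Matrix.mvPolynomialX]
  have hv : Matrix.vecMul (fun i => w (e i)) M = 0 := by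
    ext j
    have h := congrArg (fun v : EuclideanSpace ℝ (Fin d) => v j) hw
    rw [← Finset.sum_coe_sort, ← e.sum_comp] at h
    simpa [Matrix.vecMul, dotProduct, M] using h
  have h0 := Matrix.eq_zero_of_vecMul_eq_zero hdet hv
  intro x hx
  have := congrFun h0 (e.symm ⟨x, hx⟩)
  simpa using this

/-- For `k(d+1)` points in general position with respect to the origin
(coordinates algebraically independent over ℚ), the number of Birch
partitions for the origin is even. -/
theorem birch_partitions_even (d k : ℕ) (hd : 1 ≤ d) (hk : 2 ≤ k)
    (X : Finset (EuclideanSpace ℝ (Fin d))) (hcard : X.card = k * (d + 1))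
    (hgen : AlgebraicIndependent ℚ
      (fun p : {x // x ∈ X} × Fin d => (p.1 : EuclideanSpace ℝ (Fin d)) p.2)) :
    Even {P : Finset (Finset (EuclideanSpace ℝ (Fin d))) |
      IsBirchPartition d k X P}.ncard := by
  obtain ⟨k, rfl⟩ : ∃ m, k = m + 2 := ⟨k - 2, by omega⟩
  classical
  have hne : X.Nonempty := by
    rw [← Finset.card_pos, hcard]; positivity
  obtain ⟨z, hz⟩ := hne
  obtain ⟨g, hg⟩ := exists_cochain d (fun S : Finset (EuclideanSpace ℝ (Fin d)) =>
    (0 : EuclideanSpace ℝ (Fin d)) ∈ convexHull ℝ (S : Set (EuclideanSpace ℝ (Fin d)))) X z hz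
    (fun T hT hc => hull_even d hd finrank_euclideanSpace_fin T hc
      (fun R hR hRc => gen_pos d X hgen R (hR.trans hT) hRc))
  have h := BV_even d hd _ g k X hcard hg
  rw [ZMod.natCast_eq_zero_iff_even] at h
  rw [← Set.ncard_coe_finset] at h
  convert h using 2
  ext P
  rw [Finset.mem_coe, mem_BV]
  rfl
end

section
/- Let d ≥ 1, k ≥ 2, and let X be a set of k(d+1) points in ℝ^d in general position with respect to the origin. If X has at least one Birch partition for the origin, then it has at least k! Birch partitions for the origin. -/
/-- Any `d` points of `X` satisfy no nontrivial linear relation. -/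
def BirchGP (d : ℕ) (X : Finset (EuclideanSpace ℝ (Fin d))) : Prop :=
  ∀ D ⊆ X, D.card = d → ∀ f : EuclideanSpace ℝ (Fin d) → ℝ,
    ∑ v ∈ D, f v • v = 0 → ∀ v ∈ D, f v = 0

/-- The origin lies in the convex hull. -/
def BirchGood {d : ℕ} (S : Finset (EuclideanSpace ℝ (Fin d))) : Prop :=
  (0 : EuclideanSpace ℝ (Fin d)) ∈ convexHull ℝ (S : Set (EuclideanSpace ℝ (Fin d)))

lemma birchGP_of_algInd (d : ℕ) (X : Finset (EuclideanSpace ℝ (Fin d)))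
    (hgen : AlgebraicIndependent ℚ
      (fun p : {x // x ∈ X} × Fin d => (p.1 : EuclideanSpace ℝ (Fin d)) p.2)) :
    BirchGP d X := by
  classical
  intro D hD hc f hf v hv
  let e : Fin d ≃ D := (Finset.equivFinOfCardEq hc).symm
  let M : Matrix (Fin d) (Fin d) ℝ := Matrix.of fun i j => (e i : EuclideanSpace ℝ (Fin d)) j
  have h1 : AlgebraicIndependent ℚ (fun p : Fin d × Fin d => M p.1 p.2) := by
    have := hgen.comp (fun p : Fin d × Fin d => (⟨(e p.1 : EuclideanSpace ℝ (Fin d)), hD (e p.1).2⟩, p.2)) (by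
      rintro ⟨a, b⟩ ⟨a', b'⟩ h
      simp only [Prod.mk.injEq, Subtype.mk.injEq] at h
      have := e.injective (Subtype.ext h.1)
      simp [this, h.2])
    exact this
  have h2 : M.det ≠ 0 := by
    intro h0
    apply Matrix.det_mvPolynomialX_ne_zero (Fin d) ℚ
    apply h1
    rw [map_zero, AlgHom.map_det, ← h0]
    congr 1
    ext i j
    simp [Matrix.mvPolynomialX]
  have h3 : Matrix.vecMul (fun i => f (e i)) M = 0 := by
    ext j
    have := congrArg (fun w : EuclideanSpace ℝ (Fin d) => w j) hf
    simp only [Matrix.vecMul, dotProduct, M, Matrix.of_apply, Pi.zero_apply]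
    rw [← Finset.sum_coe_sort] at this
    rw [← e.sum_comp] at this
    simpa using this
  have h4 := Matrix.eq_zero_of_vecMul_eq_zero h2 h3
  have := congrFun h4 (e.symm ⟨v, hv⟩)
  simpa using this

lemma birchGood_iff {d : ℕ} (S : Finset (EuclideanSpace ℝ (Fin d))) :
    BirchGood S ↔ ∃ w : EuclideanSpace ℝ (Fin d) → ℝ,
      (∀ y ∈ S, 0 ≤ w y) ∧ ∑ y ∈ S, w y = 1 ∧ ∑ y ∈ S, w y • y = 0 := by
  unfold BirchGood
  rw [Finset.mem_convexHull']

/-- Relation on `d+2` points vanishing at two of them vanishes. -/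
lemma birch_two_zeros {d : ℕ} {X C : Finset (EuclideanSpace ℝ (Fin d))} (hX : BirchGP d X)
    (hC : C ⊆ X) (hcard : C.card = d + 2) {a b : EuclideanSpace ℝ (Fin d)} (ha : a ∈ C)
    (hb : b ∈ C) (hab : a ≠ b) (f : EuclideanSpace ℝ (Fin d) → ℝ)
    (hf : ∑ v ∈ C, f v • v = 0) (fa : f a = 0) (fb : f b = 0) : ∀ v ∈ C, f v = 0 := by
  classical
  have hb' : b ∈ C.erase a := Finset.mem_erase.2 ⟨hab.symm, hb⟩
  have := hX ((C.erase a).erase b)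
    (((Finset.erase_subset _ _).trans (Finset.erase_subset _ _)).trans hC)
    (by rw [Finset.card_erase_of_mem hb', Finset.card_erase_of_mem ha, hcard]; rfl) f
    (by
      rw [← Finset.add_sum_erase _ _ ha, ← Finset.add_sum_erase _ _ hb'] at hf
      simpa [fa, fb] using hf)
  intro v hv
  by_cases h1 : v = a
  · rw [h1, fa]
  by_cases h2 : v = b
  · rw [h2, fb]
  exact this v (by simp [h1, h2, hv])

/-- Weights for a good facet, extended by zero. -/
lemma birch_weights {d : ℕ} {X C : Finset (EuclideanSpace ℝ (Fin d))} (hX : BirchGP d X)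
    (hC : C ⊆ X) (hcard : C.card = d + 2) {a : EuclideanSpace ℝ (Fin d)} (ha : a ∈ C)
    [DecidableEq (EuclideanSpace ℝ (Fin d))]
    (hg : BirchGood (C.erase a)) : ∃ w : EuclideanSpace ℝ (Fin d) → ℝ,
      w a = 0 ∧ (∀ y ∈ C, y ≠ a → 0 < w y) ∧ ∑ y ∈ C, w y • y = 0 := by
  obtain ⟨w, h0, h1, h2⟩ := (birchGood_iff _).1 hg
  have hs : ∑ y ∈ C, (if y = a then 0 else w y) • y = 0 := by
    rw [← Finset.add_sum_erase _ _ ha, if_pos rfl, zero_smul, zero_add, ← h2]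
    exact Finset.sum_congr rfl fun y hy => by rw [if_neg (Finset.mem_erase.1 hy).1]
  refine ⟨fun y => if y = a then 0 else w y, by simp, ?_, hs⟩
  intro y hy hya
  simp only [if_neg hya]
  refine lt_of_le_of_ne (h0 y (by simp [hy, hya])) fun h => ?_
  have := birch_two_zeros hX hC hcard ha hy hya.symm _ hs (by simp) (by simp [← h])
  have h3 : ∑ y ∈ C.erase a, w y = 0 := Finset.sum_eq_zero fun z hz => by
    have := this z (Finset.mem_of_mem_erase hz)
    rwa [if_neg (Finset.mem_erase.1 hz).1] at this
  linarith

lemma birchGood_of_nonneg {d : ℕ} {C : Finset (EuclideanSpace ℝ (Fin d))}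
    [DecidableEq (EuclideanSpace ℝ (Fin d))]
    {a b : EuclideanSpace ℝ (Fin d)} (ha : a ∈ C) (hb : b ∈ C)
    (w : EuclideanSpace ℝ (Fin d) → ℝ) (w0 : ∀ y ∈ C, 0 ≤ w y) (wa : w a = 0) (wb : 0 < w b)
    (hs : ∑ y ∈ C, w y • y = 0) : BirchGood (C.erase a) := by
  have hpos : 0 < ∑ y ∈ C, w y := Finset.sum_pos' w0 ⟨b, hb, wb⟩
  rw [birchGood_iff]
  refine ⟨fun y => (∑ y ∈ C, w y)⁻¹ * w y, ?_, ?_, ?_⟩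
  · intro y hy
    have := w0 y (Finset.mem_of_mem_erase hy)
    positivity
  · rw [← Finset.mul_sum]
    rw [← Finset.add_sum_erase _ w ha, wa, zero_add] at hpos ⊢
    exact inv_mul_cancel₀ hpos.ne'
  · simp_rw [mul_smul]
    rw [← Finset.smul_sum]
    rw [← Finset.add_sum_erase _ _ ha, wa, zero_smul, zero_add] at hs
    rw [hs, smul_zero]

lemma birch_pivot {d : ℕ} {X C : Finset (EuclideanSpace ℝ (Fin d))} (hX : BirchGP d X)
    (hC : C ⊆ X) (hcard : C.card = d + 2) {b : EuclideanSpace ℝ (Fin d)} (hb : b ∈ C)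
    [DecidableEq (EuclideanSpace ℝ (Fin d))]
    (hg : BirchGood (C.erase b)) : ∃! c, c ∈ C.erase b ∧ BirchGood (C.erase c) := by
  obtain ⟨α, αb, αpos, αs⟩ := birch_weights hX hC hcard hb hg
  have hne : (C.erase b).Nonempty := by
    rw [← Finset.card_pos, Finset.card_erase_of_mem hb]; omega
  have uniq : ∀ c ∈ C.erase b, ∀ c' ∈ C.erase b, BirchGood (C.erase c) →
      BirchGood (C.erase c') → c = c' := by
    intro c hc c' hc' h h'
    by_contra hcc
    obtain ⟨hcb, hcC⟩ := Finset.mem_erase.1 hc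
    obtain ⟨hcb', hcC'⟩ := Finset.mem_erase.1 hc'
    obtain ⟨γ, γc, γpos, γs⟩ := birch_weights hX hC hcard hcC h
    obtain ⟨γ', γc', γpos', γs'⟩ := birch_weights hX hC hcard hcC' h'
    have p1 := γpos b hb hcb.symm
    have p2 := γpos' b hb hcb'.symm
    have p3 := γpos c' hcC' (Ne.symm hcc)
    have p4 := γpos' c hcC hcc
    have p5 := αpos c hcC hcb
    have p6 := αpos c' hcC' hcb'
    have key := birch_two_zeros hX hC hcard hb hcC hcb.symm
      (fun y => α c * (γ' b * γ y - γ b * γ' y) + (γ b * γ' c) * α y)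
      (by
        have : ∀ y : EuclideanSpace ℝ (Fin d),
          (α c * (γ' b * γ y - γ b * γ' y) + (γ b * γ' c) * α y) • y =
            (α c * γ' b) • (γ y • y) - (α c * γ b) • (γ' y • y) + (γ b * γ' c) • (α y • y) := by
          intro y; module
        simp_rw [this]
        rw [Finset.sum_add_distrib, Finset.sum_sub_distrib, ← Finset.smul_sum, ← Finset.smul_sum,
          ← Finset.smul_sum, γs, γs', αs]
        simp)
      (by simp only [αb]; ring) (by simp only [γc]; ring) c' hcC'
    simp only [γc'] at key
    have : 0 < α c * (γ' b * γ c') + γ b * γ' c * α c' := by positivity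
    linarith
  have exist : ∃ c ∈ C.erase b, BirchGood (C.erase c) := by
    obtain ⟨a, ha⟩ := hne
    obtain ⟨hab, haC⟩ := Finset.mem_erase.1 ha
    obtain ⟨f, fs, x, hx, fx⟩ := Module.exists_nontrivial_relation_of_finrank_lt_card
      (R := ℝ) (t := C.erase a) (by
        rw [Finset.card_erase_of_mem haC, hcard, finrank_euclideanSpace, Fintype.card_fin]; omega)
    let g : EuclideanSpace ℝ (Fin d) → ℝ := fun y => if y = a then 0 else f y
    have gs : ∑ y ∈ C, g y • y = 0 := by
      rw [← Finset.add_sum_erase _ _ haC, ← fs]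
      simp only [g, if_pos rfl, zero_smul, zero_add]
      exact Finset.sum_congr rfl fun y hy => by rw [if_neg (Finset.mem_erase.1 hy).1]
    have gb : g b ≠ 0 := by
      intro h
      have := birch_two_zeros hX hC hcard haC hb hab g gs (by simp [g]) h x
        (Finset.mem_of_mem_erase hx)
      simp only [g, if_neg (Finset.mem_erase.1 hx).1] at this
      exact fx this
    let β : EuclideanSpace ℝ (Fin d) → ℝ := fun y => (g b)⁻¹ * g y
    have βb : β b = 1 := inv_mul_cancel₀ gb
    have βs : ∑ y ∈ C, β y • y = 0 := by
      simp only [β, mul_smul]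
      rw [← Finset.smul_sum, gs, smul_zero]
    obtain ⟨c, hc, hmin⟩ := Finset.exists_min_image (C.erase b) (fun y => β y / α y) ⟨a, ha⟩
    obtain ⟨hcb, hcC⟩ := Finset.mem_erase.1 hc
    have αc := αpos c hcC hcb
    refine ⟨c, hc, birchGood_of_nonneg hcC hb (fun y => β y - β c / α c * α y) ?_ ?_ ?_ ?_⟩
    · intro y hy
      by_cases hyb : y = b
      · simp [hyb, βb, αb]
      · have h1 := hmin y (by simp [hy, hyb])
        have h2 := αpos y hy hyb
        rw [le_div_iff₀ h2] at h1
        linarith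
    · field_simp
      ring
    · simp [βb, αb]
    · simp only [sub_smul, mul_smul]
      rw [Finset.sum_sub_distrib, ← Finset.smul_sum, βs, αs]
      simp
  obtain ⟨c, hc, h⟩ := exist
  exact ⟨c, ⟨hc, h⟩, fun c' h' => uniq c' h'.1 c hc h'.2 h⟩

open Classical in
lemma birch_even {d : ℕ} {X C : Finset (EuclideanSpace ℝ (Fin d))} (hX : BirchGP d X)
    (hC : C ⊆ X) (hcard : C.card = d + 2) :
    Even (C.filter fun c => BirchGood (C.erase c)).card := by
  rcases (C.filter fun c => BirchGood (C.erase c)).eq_empty_or_nonempty with h | ⟨b, hb⟩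
  · simp [h]
  obtain ⟨hb, hg⟩ := Finset.mem_filter.1 hb
  obtain ⟨c, ⟨hc, hgc⟩, hu⟩ := birch_pivot hX hC hcard hb hg
  obtain ⟨hcb, hcC⟩ := Finset.mem_erase.1 hc
  have : (C.filter fun c => BirchGood (C.erase c)) = {b, c} := by
    ext y
    simp only [Finset.mem_filter, Finset.mem_insert, Finset.mem_singleton]
    constructor
    · rintro ⟨hy, hyg⟩
      by_cases hyb : y = b
      · exact Or.inl hyb
      · exact Or.inr (hu y ⟨by simp [hy, hyb], hyg⟩)
    · rintro (rfl | rfl)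
      · exact ⟨hb, hg⟩
      · exact ⟨hcC, hgc⟩
  rw [this, Finset.card_pair hcb.symm]
  decide

open Classical in
lemma birch_two_even {d : ℕ} (hd : 1 ≤ d) {X Y : Finset (EuclideanSpace ℝ (Fin d))}
    (hX : BirchGP d X) (hY : Y ⊆ X) (hcard : Y.card = 2 * (d + 1))
    {x : EuclideanSpace ℝ (Fin d)} (hx : x ∈ Y) :
    Even ((Y.powersetCard (d + 1)).filter
      fun B => (x ∈ B ∧ BirchGood B) ∧ BirchGood (Y \ B)).card := by
  set 𝓑 := (Y.powersetCard (d + 1)).filter fun B => x ∈ B ∧ BirchGood B with h𝓑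
  have hB : ∀ B, B ∈ 𝓑 ↔ (B ⊆ Y ∧ B.card = d + 1) ∧ x ∈ B ∧ BirchGood B := by
    intro B; simp [h𝓑, Finset.mem_powersetCard]
  rw [← Finset.filter_filter, ← h𝓑]
  have hcount : ∀ B ∈ 𝓑, ((if BirchGood (Y \ B) then 1 else 0 : ℕ) : ZMod 2) +
      ((𝓑.filter fun A => A ∩ B = {x}).card : ZMod 2) = 0 := by
    intro B hBB
    obtain ⟨⟨hBY, hBc⟩, hxB, hBg⟩ := (hB B).1 hBB
    have hxn : x ∉ Y \ B := by simp [hxB]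
    have hYB : (Y \ B).card = d + 1 := by
      rw [Finset.card_sdiff_of_subset hBY]; omega
    have hev := birch_even hX (C := insert x (Y \ B))
      ((Finset.insert_subset hx Finset.sdiff_subset).trans hY)
      (by rw [Finset.card_insert_of_notMem hxn, hYB])
    rw [Finset.filter_insert, Finset.erase_insert hxn] at hev
    have hbij : ((Y \ B).filter fun c => BirchGood ((insert x (Y \ B)).erase c)).card =
        (𝓑.filter fun A => A ∩ B = {x}).card := by
      refine Finset.card_bij (fun c _ => (insert x (Y \ B)).erase c) ?_ ?_ ?_
      · intro c hc
        obtain ⟨hc, hcg⟩ := Finset.mem_filter.1 hc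
        have hcx : x ≠ c := by rintro rfl; exact hxn hc
        rw [Finset.mem_filter, hB]
        refine ⟨⟨⟨(Finset.erase_subset _ _).trans (Finset.insert_subset hx Finset.sdiff_subset),
          ?_⟩, ?_, hcg⟩, ?_⟩
        · rw [Finset.card_erase_of_mem (Finset.mem_insert_of_mem hc),
            Finset.card_insert_of_notMem hxn, hYB]; rfl
        · simp [hcx]
        · ext y
          simp only [Finset.mem_inter, Finset.mem_erase, Finset.mem_insert, Finset.mem_sdiff,
            Finset.mem_singleton]
          constructor
          · tauto
          · rintro rfl; tauto
      · intro c hc c' hc' h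
        by_contra hne
        have h1 : c ∈ (insert x (Y \ B)).erase c' :=
          Finset.mem_erase.2 ⟨hne, Finset.mem_insert_of_mem (Finset.mem_filter.1 hc).1⟩
        rw [← h] at h1
        simp at h1
      · intro A hA
        obtain ⟨hA, hAB⟩ := Finset.mem_filter.1 hA
        obtain ⟨⟨hAY, hAc⟩, hxA, hAg⟩ := (hB A).1 hA
        have hsub : A ⊆ insert x (Y \ B) := by
          intro y hy
          by_cases hyB : y ∈ B
          · have : y ∈ A ∩ B := Finset.mem_inter.2 ⟨hy, hyB⟩
            rw [hAB] at this
            simp [Finset.mem_singleton.1 this]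
          · simp [hAY hy, hyB]
        have h1 : ((insert x (Y \ B)) \ A).card = 1 := by
          rw [Finset.card_sdiff_of_subset hsub, Finset.card_insert_of_notMem hxn, hYB, hAc]
          omega
        obtain ⟨c, hc⟩ := Finset.card_eq_one.1 h1
        have hAe : (insert x (Y \ B)).erase c = A := by
          rw [Finset.erase_eq, ← hc]
          exact Finset.sdiff_sdiff_eq_self hsub
        have hcm : c ∈ (insert x (Y \ B)) \ A := by rw [hc]; simp
        obtain ⟨hc1, hc2⟩ := Finset.mem_sdiff.1 hcm
        have hc3 : c ∈ Y \ B := by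
          rcases Finset.mem_insert.1 hc1 with rfl | h
          · exact absurd hxA hc2
          · exact h
        exact ⟨c, Finset.mem_filter.2 ⟨hc3, by rw [hAe]; exact hAg⟩, hAe⟩
    rw [← hbij, ← Nat.cast_add, ZMod.natCast_eq_zero_iff_even]
    convert hev using 1
    split_ifs
    · rw [Finset.card_insert_of_notMem (by simp [hxB]), add_comm]
    · simp
  have hsum := Finset.sum_congr rfl hcount
  rw [Finset.sum_add_distrib, Finset.sum_const_zero] at hsum
  have hzero : ∑ B ∈ 𝓑, ((𝓑.filter fun A => A ∩ B = {x}).card : ZMod 2) = 0 := by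
    have h1 : ∑ B ∈ 𝓑, ((𝓑.filter fun A => A ∩ B = {x}).card : ZMod 2) =
        ∑ p ∈ (𝓑 ×ˢ 𝓑).filter fun p => p.2 ∩ p.1 = {x}, (1 : ZMod 2) := by
      rw [Finset.sum_filter (s := 𝓑 ×ˢ 𝓑), Finset.sum_product]
      refine Finset.sum_congr rfl fun B _ => ?_
      rw [← Finset.sum_filter, Finset.sum_const, nsmul_eq_mul, mul_one]
    rw [h1]
    refine Finset.sum_involution (fun p _ => (p.2, p.1)) ?_ ?_ ?_ ?_
    · intros; decide
    · rintro ⟨A, B⟩ hp - h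
      simp only [Prod.mk.injEq] at h
      simp only [Finset.mem_filter, Finset.mem_product] at hp
      have h2 : A.card = d + 1 := ((hB A).1 hp.1.1).1.2
      rw [h.1, Finset.inter_self] at hp
      rw [hp.2, Finset.card_singleton] at h2
      omega
    · rintro ⟨A, B⟩ hp
      simp only [Finset.mem_filter, Finset.mem_product] at hp ⊢
      exact ⟨⟨hp.1.2, hp.1.1⟩, by rw [Finset.inter_comm]; exact hp.2⟩
    · rintro ⟨A, B⟩ hp
      rfl
  rw [hzero, add_zero, ← Nat.cast_sum, ZMod.natCast_eq_zero_iff_even,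
    ← Finset.card_filter] at hsum
  exact hsum

open Classical in
lemma birch_second {d : ℕ} (hd : 1 ≤ d) {X S T : Finset (EuclideanSpace ℝ (Fin d))}
    (hX : BirchGP d X) (hS : S ⊆ X) (hT : T ⊆ X) (hSc : S.card = d + 1) (hTc : T.card = d + 1)
    (hST : Disjoint S T) (gS : BirchGood S) (gT : BirchGood T)
    {x : EuclideanSpace ℝ (Fin d)} (hx : x ∈ S) :
    ∃ A, A ⊆ S ∪ T ∧ A.card = d + 1 ∧ x ∈ A ∧ A ≠ S ∧ BirchGood A ∧
      BirchGood ((S ∪ T) \ A) := by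
  have hev := birch_two_even hd hX (Finset.union_subset hS hT)
    (by rw [Finset.card_union_of_disjoint hST]; omega) (Finset.mem_union_left T hx)
  have hmem : S ∈ ((S ∪ T).powersetCard (d + 1)).filter
      fun B => (x ∈ B ∧ BirchGood B) ∧ BirchGood ((S ∪ T) \ B) := by
    rw [Finset.mem_filter, Finset.mem_powersetCard]
    refine ⟨⟨Finset.subset_union_left, hSc⟩, ⟨hx, gS⟩, ?_⟩
    rwa [Finset.union_sdiff_cancel_left hST]
  have h1 : 1 < (((S ∪ T).powersetCard (d + 1)).filter
      fun B => (x ∈ B ∧ BirchGood B) ∧ BirchGood ((S ∪ T) \ B)).card := by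
    have := Finset.card_pos.2 ⟨S, hmem⟩
    obtain ⟨m, hm⟩ := hev
    omega
  obtain ⟨A, hA, hne⟩ := Finset.exists_mem_ne h1 S
  rw [Finset.mem_filter, Finset.mem_powersetCard] at hA
  exact ⟨A, hA.1.1, hA.1.2, hA.2.1.1, hne, hA.2.1.2, hA.2.2⟩

lemma birch_disjoint {d k : ℕ} {X : Finset (EuclideanSpace ℝ (Fin d))}
    {P : Finset (Finset (EuclideanSpace ℝ (Fin d)))} (hP : IsBirchPartition d k X P)
    {S T : Finset (EuclideanSpace ℝ (Fin d))} (hS : S ∈ P) (hT : T ∈ P) (hne : S ≠ T) :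
    Disjoint S T := by
  rw [Finset.disjoint_left]
  intro x hxS hxT
  exact hne ((hP.2.2 x ((hP.2.1 S hS).1 hxS)).unique ⟨hS, hxS⟩ ⟨hT, hxT⟩)

open Classical in
lemma birch_erase {d k : ℕ} {X : Finset (EuclideanSpace ℝ (Fin d))}
    {P : Finset (Finset (EuclideanSpace ℝ (Fin d)))} (hP : IsBirchPartition d (k + 1) X P)
    {S : Finset (EuclideanSpace ℝ (Fin d))} (hS : S ∈ P) :
    IsBirchPartition d k (X \ S) (P.erase S) := by
  refine ⟨by rw [Finset.card_erase_of_mem hS, hP.1]; rfl, ?_, ?_⟩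
  · intro T hT
    obtain ⟨hTS, hTP⟩ := Finset.mem_erase.1 hT
    refine ⟨?_, (hP.2.1 T hTP).2⟩
    rw [Finset.subset_sdiff]
    exact ⟨(hP.2.1 T hTP).1, birch_disjoint hP hTP hS hTS⟩
  · intro x hx
    obtain ⟨hxX, hxS⟩ := Finset.mem_sdiff.1 hx
    obtain ⟨T, ⟨hT, hxT⟩, hu⟩ := hP.2.2 x hxX
    refine ⟨T, ⟨Finset.mem_erase.2 ⟨?_, hT⟩, hxT⟩, ?_⟩
    · rintro rfl; exact hxS hxT
    · rintro T' ⟨hT', hx'⟩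
      exact hu T' ⟨Finset.mem_of_mem_erase hT', hx'⟩

open Classical in
lemma birch_insert {d k : ℕ} {X : Finset (EuclideanSpace ℝ (Fin d))}
    {Q : Finset (Finset (EuclideanSpace ℝ (Fin d)))} {A : Finset (EuclideanSpace ℝ (Fin d))}
    (hA : A ⊆ X) (hAc : A.card = d + 1) (hAg : BirchGood A)
    (hQ : IsBirchPartition d k (X \ A) Q) :
    A ∉ Q ∧ IsBirchPartition d (k + 1) X (insert A Q) := by
  have hdis : ∀ S ∈ Q, ∀ y ∈ S, y ∉ A := fun S hS y hy =>
    (Finset.mem_sdiff.1 ((hQ.2.1 S hS).1 hy)).2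
  have hAQ : A ∉ Q := by
    intro h
    obtain ⟨y, hy⟩ : A.Nonempty := by rw [← Finset.card_pos]; omega
    exact hdis A h y hy hy
  refine ⟨hAQ, by rw [Finset.card_insert_of_notMem hAQ, hQ.1], ?_, ?_⟩
  · intro S hS
    rcases Finset.mem_insert.1 hS with rfl | hS
    · exact ⟨hA, hAc, hAg⟩
    · exact ⟨(hQ.2.1 S hS).1.trans Finset.sdiff_subset, (hQ.2.1 S hS).2⟩
  · intro x hx
    by_cases hxA : x ∈ A
    · refine ⟨A, ⟨Finset.mem_insert_self _ _, hxA⟩, ?_⟩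
      rintro S ⟨hS, hxS⟩
      rcases Finset.mem_insert.1 hS with rfl | hS
      · rfl
      · exact absurd hxA (hdis S hS x hxS)
    · obtain ⟨T, ⟨hT, hxT⟩, hu⟩ := hQ.2.2 x (Finset.mem_sdiff.2 ⟨hx, hxA⟩)
      refine ⟨T, ⟨Finset.mem_insert_of_mem hT, hxT⟩, ?_⟩
      rintro S ⟨hS, hxS⟩
      rcases Finset.mem_insert.1 hS with rfl | hS
      · exact absurd hxS hxA
      · exact hu S ⟨hS, hxS⟩

lemma birch_finite (d k : ℕ) (X : Finset (EuclideanSpace ℝ (Fin d))) :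
    {P | IsBirchPartition d k X P}.Finite := by
  refine (X.powerset.powerset).finite_toSet.subset ?_
  intro P hP
  simp only [Finset.mem_coe, Finset.mem_powerset]
  intro S hS
  exact Finset.mem_powerset.2 (hP.2.1 S hS).1

open Classical in
lemma birch_exchange {d k : ℕ} (hd : 1 ≤ d) {X : Finset (EuclideanSpace ℝ (Fin d))}
    (hX : BirchGP d X) {P : Finset (Finset (EuclideanSpace ℝ (Fin d)))}
    (hP : IsBirchPartition d (k + 1) X P) {x : EuclideanSpace ℝ (Fin d)}
    {S : Finset (EuclideanSpace ℝ (Fin d))} (hS : S ∈ P) (hxS : x ∈ S)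
    {T : Finset (EuclideanSpace ℝ (Fin d))} (hT : T ∈ P) :
    ∃ A, A ⊆ X ∧ A.card = d + 1 ∧ x ∈ A ∧ BirchGood A ∧ A ⊆ S ∪ T ∧ (∃ y ∈ A, y ∈ T) ∧
      (T = S → A = S) ∧ (T ≠ S → A ≠ S) ∧
      ∃ Q, IsBirchPartition d k (X \ A) Q := by
  obtain ⟨hSX, hSc, hSg⟩ := hP.2.1 S hS
  obtain ⟨hTX, hTc, hTg⟩ := hP.2.1 T hT
  by_cases hTS : T = S
  · subst hTS
    exact ⟨T, hSX, hSc, hxS, hSg, by simp, ⟨x, hxS, hxS⟩, fun _ => rfl, fun h => absurd rfl h,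
      _, birch_erase hP hS⟩
  · have hdis := birch_disjoint hP hS hT (Ne.symm hTS)
    obtain ⟨A, hAsub, hAc, hxA, hne, hAg, hAg'⟩ :=
      birch_second hd hX hSX hTX hSc hTc hdis hSg hTg hxS
    refine ⟨A, hAsub.trans (Finset.union_subset hSX hTX), hAc, hxA, hAg, hAsub, ?_,
      fun h => absurd h hTS, fun _ => hne, ?_⟩
    · by_contra! h
      apply hne
      refine Finset.eq_of_subset_of_card_le ?_ (by omega)
      intro y hy
      rcases Finset.mem_union.1 (hAsub hy) with h1 | h1
      · exact h1
      · exact absurd h1 (h y hy)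
    · obtain _ | k := k
      · exact absurd (Finset.card_le_one.1 hP.1.le T hT S hS) hTS
      have h1 := birch_erase (birch_erase hP hS) (Finset.mem_erase.2 ⟨hTS, hT⟩)
      have hset : (X \ A) \ ((S ∪ T) \ A) = (X \ S) \ T := by
        ext y
        have := @hAsub y
        simp only [Finset.mem_sdiff, Finset.mem_union] at this ⊢
        tauto
      rw [← hset] at h1
      refine ⟨_, (birch_insert (Finset.sdiff_subset_sdiff (Finset.union_subset hSX hTX) le_rfl)
        ?_ hAg' h1).2⟩
      rw [Finset.card_sdiff_of_subset hAsub, Finset.card_union_of_disjoint hdis]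
      omega

lemma birch_main (d : ℕ) (hd : 1 ≤ d) (k : ℕ) : ∀ (X : Finset (EuclideanSpace ℝ (Fin d))),
    X.card = k * (d + 1) → BirchGP d X → (∃ P, IsBirchPartition d k X P) →
    Nat.factorial k ≤ {P | IsBirchPartition d k X P}.ncard := by
  classical
  induction k with
  | zero =>
    intro X _ _ h
    rw [Nat.factorial_zero, Nat.one_le_iff_ne_zero, ← Nat.pos_iff_ne_zero,
      Set.ncard_pos (birch_finite d 0 X)]
    exact h
  | succ k ih =>
    rintro X hXc hX ⟨P, hP⟩
    obtain ⟨x, hx⟩ : X.Nonempty := by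
      rw [← Finset.card_pos, hXc]; positivity
    obtain ⟨S, ⟨hS, hxS⟩, -⟩ := hP.2.2 x hx
    have hex := fun T (hT : T ∈ P) => birch_exchange hd hX hP hS hxS hT
    choose! A hAX hAc hxA hAg hAsub hAT hAS hAS' hAQ using hex
    have hinj : ∀ T ∈ P, ∀ T' ∈ P, A T = A T' → T = T' := by
      intro T hT T' hT' h
      by_cases h1 : T = S
      · by_contra h2
        exact hAS' T' hT' (fun h3 => h2 (h1.trans h3.symm)) (h ▸ hAS T hT h1)
      by_cases h1' : T' = S
      · exact absurd (h.trans (hAS T' hT' h1')) (hAS' T hT h1)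
      obtain ⟨y, hyA, hyT⟩ := hAT T hT
      by_contra h2
      rw [h] at hyA
      rcases Finset.mem_union.1 (hAsub T' hT' hyA) with h3 | h3
      · exact Finset.disjoint_left.1 (birch_disjoint hP hT hS h1) hyT h3
      · exact Finset.disjoint_left.1 (birch_disjoint hP hT hT' h2) hyT h3
    let F : Finset (EuclideanSpace ℝ (Fin d)) →
      Finset (Finset (Finset (EuclideanSpace ℝ (Fin d)))) := fun T =>
        (birch_finite d k (X \ A T)).toFinset
    have hF : ∀ T ∈ P, Nat.factorial k ≤ (F T).card := by
      intro T hT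
      rw [← Set.ncard_eq_toFinset_card _ (birch_finite d k (X \ A T))]
      refine ih _ ?_ ?_ (hAQ T hT)
      · rw [Finset.card_sdiff_of_subset (hAX T hT), hXc, hAc T hT, Nat.succ_mul]
        omega
      · exact fun D hD => hX D (hD.trans Finset.sdiff_subset)
    have hmemF : ∀ T Q, Q ∈ F T ↔ IsBirchPartition d k (X \ A T) Q := by
      intro T Q; simp [F]
    have hins : ∀ T ∈ P, ∀ Q ∈ F T, A T ∉ Q ∧ IsBirchPartition d (k + 1) X (insert (A T) Q) :=
      fun T hT Q hQ => birch_insert (hAX T hT) (hAc T hT) (hAg T hT) ((hmemF T Q).1 hQ)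
    rw [Set.ncard_eq_toFinset_card _ (birch_finite d (k + 1) X)]
    calc Nat.factorial (k + 1) = ∑ T ∈ P, Nat.factorial k := by
          rw [Finset.sum_const, hP.1, Nat.factorial_succ, smul_eq_mul]
      _ ≤ ∑ T ∈ P, (F T).card := Finset.sum_le_sum hF
      _ = (P.sigma F).card := (Finset.card_sigma _ _).symm
      _ ≤ _ := by
        refine Finset.card_le_card_of_injOn (fun p => insert (A p.1) p.2) ?_ ?_
        · rintro ⟨T, Q⟩ h
          obtain ⟨hT, hQ⟩ := Finset.mem_sigma.1 (Finset.mem_coe.1 h)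
          simpa using (hins T hT Q hQ).2
        · rintro ⟨T, Q⟩ h ⟨T', Q'⟩ h' heq
          obtain ⟨hT, hQ⟩ := Finset.mem_sigma.1 (Finset.mem_coe.1 h)
          obtain ⟨hT', hQ'⟩ := Finset.mem_sigma.1 (Finset.mem_coe.1 h')
          simp only at heq hT hQ hT' hQ'
          have hAA : A T = A T' := by
            refine ((hins T hT Q hQ).2.2.2 x hx).unique
              ⟨Finset.mem_insert_self _ _, hxA T hT⟩ ⟨?_, hxA T' hT'⟩
            rw [heq]
            exact Finset.mem_insert_self _ _
          have hTT := hinj T hT T' hT' hAA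
          subst hTT
          have hQQ : Q = Q' := by
            rw [← Finset.erase_insert (hins T hT Q hQ).1, heq,
              Finset.erase_insert (hins T hT Q' hQ').1]
          rw [hQQ]

/-- For `k(d+1)` points in general position with respect to the origin:
if there is at least one Birch partition for the origin, then
there are at least `k!` of them. -/
theorem birch_partitions_lower_bound (d k : ℕ) (hd : 1 ≤ d) (hk : 2 ≤ k)
    (X : Finset (EuclideanSpace ℝ (Fin d))) (hcard : X.card = k * (d + 1))
    (hgen : AlgebraicIndependent ℚ
      (fun p : {x // x ∈ X} × Fin d => (p.1 : EuclideanSpace ℝ (Fin d)) p.2))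
    (hne : ∃ P, IsBirchPartition d k X P) :
    Nat.factorial k ≤ {P : Finset (Finset (EuclideanSpace ℝ (Fin d))) |
      IsBirchPartition d k X P}.ncard := by
  exact birch_main d hd k X hcard (birchGP_of_algInd d X hgen) hne
end
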